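/- arXiv:1804.04304 — 2 statements merged into one kernel-verified Lean document; each statement's English description precedes it below -/
import Mathlib

section
/- Let Ω ⊂⊂ ℝⁿ be a bounded convex domain with C^k boundary, k ≥ 1 (i.e., there exists a C^k real-valued function σ on a neighborhood of cl(Ω) with Ω = {σ < 0} and ∇σ ≠ 0 on ∂Ω). Then there exists a C^k function ρ : ℝⁿ → ℝ such that: (1) ρ is a defining function of Ω, i.e., Ω = {x ∈ ℝⁿ : ρ(x) < 0} and ∇ρ(x) ≠ 0 for all x ∈ ∂Ω; and (2) ρ is convex on ℝⁿ and strictly convex on a neighborhood of every point of ℝⁿ ∖ ∂Ω (in particular, ρ is strictly convex on Ω and on every convex subset of ℝⁿ ∖ cl(Ω)). -/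
open Set Filter Topology

theorem ConvexOn.hasFDerivAt_apply_sub_le {E : Type*} [NormedAddCommGroup E] [NormedSpace ℝ E]
    {f : E → ℝ} {L : E →L[ℝ] ℝ} {y : E} (hf : ConvexOn ℝ univ f) (hL : HasFDerivAt f L y)
    (w : E) : L (w - y) ≤ f w - f y := by
  have hline : HasDerivAt (fun s : ℝ => f (y + s • (w - y))) (L (w - y)) 0 := by
    have h1 : HasDerivAt (fun s : ℝ => y + s • (w - y)) (w - y) 0 := by
      simpa using ((hasDerivAt_id (0 : ℝ)).smul_const (w - y)).const_add y
    have h2 : HasFDerivAt f L (y + (0 : ℝ) • (w - y)) := by simpa using hL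
    exact h2.comp_hasDerivAt 0 h1
  refine le_of_tendsto hline.tendsto_slope_zero_right ?_
  filter_upwards [Ioo_mem_nhdsGT (zero_lt_one (α := ℝ))] with s hs
  have h := hf.2 (mem_univ y) (mem_univ w) (sub_nonneg.2 hs.2.le) hs.1.le (by ring)
  have e : y + s • (w - y) = (1 - s) • y + s • w := by module
  simp only [zero_add, zero_smul, add_zero, smul_eq_mul, e] at h ⊢
  rw [inv_mul_le_iff₀ hs.1]
  linarith

theorem Convex.hasFDerivAt_apply_sub_neg {E : Type*} [NormedAddCommGroup E] [NormedSpace ℝ E]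
    {S : Set E} {σ : E → ℝ} {L : E →L[ℝ] ℝ} {y w : E} (hS : Convex ℝ S) (hSo : IsOpen S)
    (hy : y ∈ closure S) (hL : HasFDerivAt σ L y) (hσy : σ y = 0) (hneg : ∀ x ∈ S, σ x ≤ 0)
    (hL0 : L ≠ 0) (hw : w ∈ S) : L (w - y) < 0 := by
  have hle : ∀ v ∈ S, L (v - y) ≤ 0 := by
    intro v hv
    have hline : HasDerivAt (fun s : ℝ => σ (y + s • (v - y))) (L (v - y)) 0 := by
      have h1 : HasDerivAt (fun s : ℝ => y + s • (v - y)) (v - y) 0 := by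
        simpa using ((hasDerivAt_id (0 : ℝ)).smul_const (v - y)).const_add y
      have h2 : HasFDerivAt σ L (y + (0 : ℝ) • (v - y)) := by simpa using hL
      exact h2.comp_hasDerivAt 0 h1
    refine le_of_tendsto hline.tendsto_slope_zero_right ?_
    filter_upwards [Ioo_mem_nhdsGT (zero_lt_one (α := ℝ))] with s hs
    have hm : y + s • (v - y) ∈ S := by
      rw [← hSo.interior_eq] at hv ⊢
      exact hS.add_smul_sub_mem_interior' hy hv ⟨hs.1, hs.2.le⟩
    simp only [zero_add, zero_smul, add_zero, smul_eq_mul, hσy, sub_zero]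
    exact mul_nonpos_of_nonneg_of_nonpos (inv_nonneg.2 hs.1.le) (hneg _ hm)
  refine lt_of_le_of_ne (hle w hw) fun h0 => hL0 ?_
  have hdir : ∀ v, L v ≤ 0 := by
    intro v
    have hc : Tendsto (fun s : ℝ => w + s • v) (𝓝[>] 0) (𝓝 w) := by
      have : Continuous (fun s : ℝ => w + s • v) := by fun_prop
      simpa using (this.tendsto 0).mono_left nhdsWithin_le_nhds
    obtain ⟨s, hsS, hs⟩ :=
      ((hc.eventually (hSo.mem_nhds hw)).and self_mem_nhdsWithin).exists
    have h := hle _ hsS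
    have e : L (w + s • v - y) = L (w - y) + s * L v := by
      rw [add_sub_right_comm, map_add, map_smul, smul_eq_mul]
    rw [e, h0, zero_add] at h
    exact nonpos_of_mul_nonpos_right h hs
  ext v
  have h1 := hdir v
  have h2 := hdir (-v)
  rw [map_neg] at h2
  simp only [_root_.zero_apply]
  linarith

theorem contDiff_max_zero_pow (k : ℕ) : ContDiff ℝ k (fun u : ℝ => max u 0 ^ (k + 1)) := by
  induction k with
  | zero =>
    rw [Nat.cast_zero, contDiff_zero]
    fun_prop
  | succ k ih =>
    have hd : ∀ u : ℝ, HasDerivAt (fun u : ℝ => max u 0 ^ (k + 1 + 1))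
        ((k + 2 : ℝ) * max u 0 ^ (k + 1)) u := by
      intro u
      rcases lt_trichotomy u 0 with hu | rfl | hu
      · have h : (fun u : ℝ => max u 0 ^ (k + 1 + 1)) =ᶠ[𝓝 u] fun _ => 0 := by
          filter_upwards [gt_mem_nhds hu] with v hv
          simp [max_eq_right hv.le]
        simpa [max_eq_right hu.le] using (hasDerivAt_const u (0 : ℝ)).congr_of_eventuallyEq h
      · have hpow : HasDerivAt (fun u : ℝ => u ^ (k + 1 + 1)) 0 0 := by
          simpa using hasDerivAt_pow (k + 1 + 1) (0 : ℝ)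
        rw [hasDerivAt_iff_isLittleO] at hpow ⊢
        refine Asymptotics.IsBigO.trans_isLittleO (.of_bound 1 (.of_forall fun v => ?_)) hpow
        rcases le_total v 0 with hv | hv <;> simp [hv]
      · have h : (fun u : ℝ => max u 0 ^ (k + 1 + 1)) =ᶠ[𝓝 u] fun u => u ^ (k + 1 + 1) := by
          filter_upwards [lt_mem_nhds hu] with v hv
          simp [max_eq_left hv.le]
        refine ((hasDerivAt_pow (k + 1 + 1) u).congr_of_eventuallyEq h).congr_deriv ?_
        rw [max_eq_left hu.le, Nat.add_sub_cancel]
        push_cast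
        ring
    rw [Nat.cast_succ, contDiff_succ_iff_deriv]
    refine ⟨fun u => (hd u).differentiableAt, by simp, ?_⟩
    rw [funext fun u => (hd u).deriv]
    exact contDiff_const.mul ih

theorem contDiffAt_gauge {E : Type*} [NormedAddCommGroup E] [NormedSpace ℝ E] [CompleteSpace E]
    {S W : Set E} {σ : E → ℝ} {m : WithTop ℕ∞} (hm : m ≠ 0) (hSo : IsOpen S) (hS : Convex ℝ S)
    (hS0 : (0 : E) ∈ S) (hSb : Bornology.IsBounded S) (hWo : IsOpen W) (hSW : closure S ⊆ W)
    (hσ : ContDiffOn ℝ m σ W) (hSσ : ∀ x ∈ W, x ∈ S ↔ σ x < 0)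
    (hσ' : ∀ x ∈ frontier S, fderiv ℝ σ x ≠ 0) {x : E} (hx : x ≠ 0) :
    ContDiffAt ℝ m (gauge S) x := by
  have hSn : S ∈ 𝓝 (0 : E) := hSo.mem_nhds hS0
  have hSa : Absorbent ℝ S := absorbent_nhds_zero hSn
  have hpos : ∀ z : E, z ≠ 0 → 0 < gauge S z := fun z hz =>
    (gauge_pos hSa (NormedSpace.isVonNBounded_of_isBounded ℝ hSb)).2 hz
  have hfr : ∀ z : E, z ≠ 0 → (gauge S z)⁻¹ • z ∈ frontier S := by
    intro z hz
    rw [← gauge_eq_one_iff_mem_frontier hS hSn,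
      gauge_smul_of_nonneg (inv_nonneg.2 (gauge_nonneg _)), smul_eq_mul,
      inv_mul_cancel₀ (hpos z hz).ne']
  have hzero : ∀ z ∈ frontier S, σ z = 0 := by
    intro z hz
    have hzW := hSW hz.1
    refine le_antisymm ?_ ?_
    · have hc : ContinuousWithinAt σ S z :=
        ((hσ.continuousOn.continuousAt (hWo.mem_nhds hzW))).continuousWithinAt
      have := hc.mem_closure_image hz.1
      refine (closure_minimal ?_ isClosed_Iic : closure (σ '' S) ⊆ Iic 0) this
      rintro _ ⟨v, hv, rfl⟩
      exact ((hSσ v (hSW (subset_closure hv))).1 hv).le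
    · by_contra! h
      have := (hSσ z hzW).2 h
      rw [hSo.frontier_eq] at hz
      exact hz.2 this
  set s₀ := (gauge S x)⁻¹ with hs₀
  have hs₀pos : 0 < s₀ := inv_pos.2 (hpos x hx)
  set y := s₀ • x with hy
  have hyf : y ∈ frontier S := hfr x hx
  have hσy : ContDiffAt ℝ m σ y := hσ.contDiffAt (hWo.mem_nhds (hSW hyf.1))
  have hσd : HasFDerivAt σ (fderiv ℝ σ y) y := (hσy.differentiableAt hm).hasFDerivAt
  have hneg : fderiv ℝ σ y (0 - y) < 0 :=
    hS.hasFDerivAt_apply_sub_neg hSo hyf.1 hσd (hzero y hyf)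
      (fun v hv => ((hSσ v (hSW (subset_closure hv))).1 hv).le) (hσ' y hyf) hS0
  have hne : fderiv ℝ σ y x ≠ 0 := by
    intro h
    rw [zero_sub, map_neg, hy, map_smul, ← hy, h] at hneg
    simp at hneg
  let f : E × ℝ → ℝ := fun q => σ (q.2 • q.1)
  have hf : ContDiffAt ℝ m f (x, s₀) :=
    ContDiffAt.comp (x, s₀) (g := σ) (f := fun q : E × ℝ => q.2 • q.1) hσy
      (contDiffAt_snd.smul contDiffAt_fst)
  have hpart : (fderiv ℝ f (x, s₀) ∘L .inr ℝ E ℝ) 1 = fderiv ℝ σ y x := by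
    have h1 : HasDerivAt (fun s : ℝ => f (x, s)) (fderiv ℝ f (x, s₀) (0, 1)) s₀ :=
      (hf.differentiableAt hm).hasFDerivAt.comp_hasDerivAt s₀
        ((hasDerivAt_const s₀ x).prodMk (hasDerivAt_id s₀))
    have h2 : HasDerivAt (fun s : ℝ => σ (s • x)) (fderiv ℝ σ y x) s₀ := by
      have := (hasDerivAt_id s₀).smul_const x
      rw [one_smul] at this
      exact hσd.comp_hasDerivAt s₀ this
    simpa using h1.unique h2
  have hinv : (fderiv ℝ f (x, s₀) ∘L .inr ℝ E ℝ).IsInvertible := by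
    refine ⟨ContinuousLinearEquiv.unitsEquivAut ℝ (Units.mk0 _ hne), ?_⟩
    ext
    simp only [ContinuousLinearEquiv.coe_coe, ContinuousLinearEquiv.unitsEquivAut_apply, hpart,
      Units.val_mk0, one_mul]
  have himp := hf.contDiffAt_implicitFunction hm hinv
  have hcont : ContinuousAt (fun z => (z, (gauge S z)⁻¹)) x :=
    continuousAt_id.prodMk ((continuous_gauge hS hSn).continuousAt.inv₀ (hpos x hx).ne')
  have hev : ∀ᶠ z in 𝓝 x, hf.implicitFunction hm hinv z = (gauge S z)⁻¹ := by
    have h := hcont.tendsto.eventually (hf.eventually_apply_eq_iff_implicitFunction hm hinv)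
    filter_upwards [h, isOpen_ne.mem_nhds hx] with z hz hz0
    refine hz.1 ?_
    simp only [f]
    rw [hzero _ (hfr z hz0), ← hy, hzero y hyf]
  have : ContDiffAt ℝ m (fun z => (gauge S z)⁻¹) x :=
    himp.congr_of_eventuallyEq (hev.mono fun z hz => hz.symm)
  exact (this.inv hs₀pos.ne').congr_of_eventuallyEq (.of_forall fun z => (inv_inv _).symm)

theorem convexOn_gauge {E : Type*} [AddCommGroup E] [Module ℝ E] {S : Set E}
    (hS : Convex ℝ S) (hSa : Absorbent ℝ S) : ConvexOn ℝ univ (gauge S) := by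
  refine ⟨convex_univ, fun x _ y _ a b ha hb _ => ?_⟩
  refine (gauge_add_le hS hSa _ _).trans_eq ?_
  rw [gauge_smul_of_nonneg ha, gauge_smul_of_nonneg hb]

/-- A convex `C^k` function which defines the open convex set `S`, is bounded below by `-1`, and
grows at least linearly. -/
structure IsProperConvexDefiningFunction {E : Type*} [NormedAddCommGroup E] [NormedSpace ℝ E]
    (k : ℕ) (S : Set E) (t : E → ℝ) : Prop where
  contDiff : ContDiff ℝ k t
  convexOn : ConvexOn ℝ univ t
  neg_iff : ∀ x, t x < 0 ↔ x ∈ S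
  mem_frontier : ∀ x, t x = 0 → x ∈ frontier S
  neg_one_le : ∀ x, -1 ≤ t x
  exists_norm_le : ∃ C : ℝ, 0 < C ∧ ∀ x, ‖x‖ ≤ C * (t x + 2)

theorem isProperConvexDefiningFunction_gauge {E : Type*} [NormedAddCommGroup E] [NormedSpace ℝ E]
    [CompleteSpace E] {S W : Set E} {σ : E → ℝ} {k : ℕ} (hk : k ≠ 0) (hSo : IsOpen S)
    (hS : Convex ℝ S) (hS0 : (0 : E) ∈ S) (hSb : Bornology.IsBounded S) (hWo : IsOpen W)
    (hSW : closure S ⊆ W) (hσ : ContDiffOn ℝ k σ W) (hSσ : ∀ x ∈ W, x ∈ S ↔ σ x < 0)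
    (hσ' : ∀ x ∈ frontier S, fderiv ℝ σ x ≠ 0) :
    IsProperConvexDefiningFunction k S
      (fun x => max (2 * gauge S x - 1) 0 ^ (k + 1) - 1) := by
  have hSn : S ∈ 𝓝 (0 : E) := hSo.mem_nhds hS0
  have hSa : Absorbent ℝ S := absorbent_nhds_zero hSn
  have hgc := continuous_gauge hS hSn
  have hnn : ∀ x, 0 ≤ max (2 * gauge S x - 1) 0 := fun x => le_max_right _ _
  constructor
  · rw [contDiff_iff_contDiffAt]
    intro x
    rcases eq_or_ne x 0 with rfl | hx
    · have h : (fun x => max (2 * gauge S x - 1) 0 ^ (k + 1) - 1) =ᶠ[𝓝 (0 : E)] fun _ => -1 := by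
        have : ∀ᶠ x in 𝓝 (0 : E), gauge S x < 1 / 2 :=
          hgc.continuousAt.eventually_lt_const (by simp)
        filter_upwards [this] with x hx
        rw [max_eq_right (by linarith)]
        simp
      exact contDiffAt_const.congr_of_eventuallyEq h
    · have hg := contDiffAt_gauge (by exact_mod_cast hk) hSo hS hS0 hSb hWo hSW hσ hSσ hσ' hx
      have h2 : ContDiffAt ℝ k (fun x => 2 * gauge S x - 1) x :=
        (contDiffAt_const.mul hg).sub contDiffAt_const
      exact (((contDiff_max_zero_pow k).contDiffAt).comp x h2).sub contDiffAt_const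
  · have h1 : ConvexOn ℝ univ (fun x => 2 * gauge S x - 1) :=
      (((convexOn_gauge hS hSa).smul (zero_le_two (α := ℝ))).add_const (-1))
    have h2 := (h1.sup (convexOn_const (0 : ℝ) convex_univ)).pow (fun x _ => hnn x) (k + 1)
    exact h2.add_const (-1)
  · intro x
    rw [sub_neg, pow_lt_one_iff_of_nonneg (hnn x) k.succ_ne_zero, max_lt_iff,
      ← hSo.interior_eq, ← gauge_lt_one_iff_mem_interior hS hSn, hSo.interior_eq]
    constructor
    · intro h; linarith [h.1]
    · intro h; exact ⟨by linarith, one_pos⟩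
  · intro x hx
    rw [sub_eq_zero, pow_eq_one_iff_of_nonneg (hnn x) k.succ_ne_zero] at hx
    rw [← gauge_eq_one_iff_mem_frontier hS hSn]
    rcases max_choice (2 * gauge S x - 1) 0 with h | h <;> linarith
  · intro x
    linarith [pow_nonneg (hnn x) (k + 1)]
  · obtain ⟨r, hr, hSr⟩ := hSb.subset_closedBall_lt 0 0
    refine ⟨r, hr, fun x => ?_⟩
    have h1 : ‖x‖ / r ≤ gauge S x := le_gauge_of_subset_closedBall hSa hr.le hSr
    have h3 : 2 * gauge S x - 1 ≤ max (2 * gauge S x - 1) 0 := le_max_left _ _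
    have h4 : max (2 * gauge S x - 1) 0 ≤ max (2 * gauge S x - 1) 0 ^ (k + 1) + 1 := by
      rcases le_total (max (2 * gauge S x - 1) 0) 1 with h | h
      · linarith [pow_nonneg (hnn x) (k + 1)]
      · have h5 := le_self_pow₀ h (n := k + 1) k.succ_ne_zero
        linarith
    rw [div_le_iff₀ hr, mul_comm] at h1
    refine h1.trans (mul_le_mul_of_nonneg_left ?_ hr.le)
    linarith [pow_nonneg (hnn x) (k + 1)]

theorem IsProperConvexDefiningFunction.comp_sub {E : Type*} [NormedAddCommGroup E]
    [NormedSpace ℝ E] {k : ℕ} {S : Set E} {t : E → ℝ} {p : E}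
    (h : IsProperConvexDefiningFunction k ((· + p) ⁻¹' S) t) :
    IsProperConvexDefiningFunction k S (fun x => t (x - p)) where
  contDiff := h.contDiff.comp (contDiff_id.sub contDiff_const)
  convexOn := by
    simpa [sub_eq_add_neg, Function.comp_def] using h.convexOn.translate_left (c := -p)
  neg_iff x := by simpa using h.neg_iff (x - p)
  mem_frontier x hx := by
    have := h.mem_frontier _ hx
    rw [← Homeomorph.coe_addRight, ← Homeomorph.preimage_frontier] at this
    simpa using this
  neg_one_le x := h.neg_one_le _
  exists_norm_le := by
    obtain ⟨C, hC, hb⟩ := h.exists_norm_le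
    refine ⟨C + ‖p‖, by positivity, fun x => ?_⟩
    have h1 := hb (x - p)
    have h2 := h.neg_one_le (x - p)
    have h3 : ‖x‖ ≤ ‖x - p‖ + ‖p‖ := by simpa using norm_add_le (x - p) p
    nlinarith [norm_nonneg p]

theorem exists_isProperConvexDefiningFunction {E : Type*} [NormedAddCommGroup E] [NormedSpace ℝ E]
    [CompleteSpace E] {S W : Set E} {σ : E → ℝ} {k : ℕ} (hk : k ≠ 0) (hSo : IsOpen S)
    (hS : Convex ℝ S) (hSne : S.Nonempty) (hSb : Bornology.IsBounded S) (hWo : IsOpen W)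
    (hSW : closure S ⊆ W) (hσ : ContDiffOn ℝ k σ W) (hSσ : ∀ x ∈ W, x ∈ S ↔ σ x < 0)
    (hσ' : ∀ x ∈ frontier S, fderiv ℝ σ x ≠ 0) :
    ∃ t, IsProperConvexDefiningFunction k S t := by
  obtain ⟨p, hp⟩ := hSne
  have hc : Continuous (· + p : E → E) := by fun_prop
  have hcl : closure ((· + p) ⁻¹' S) = (· + p) ⁻¹' closure S :=
    ((Homeomorph.addRight p).preimage_closure S).symm
  have hfr : frontier ((· + p) ⁻¹' S) = (· + p) ⁻¹' frontier S :=
    ((Homeomorph.addRight p).preimage_frontier S).symm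
  refine ⟨_, (isProperConvexDefiningFunction_gauge (W := (· + p) ⁻¹' W)
    (σ := fun x => σ (x + p)) hk (hSo.preimage hc)
    (hS.translate_preimage_left p) (by simpa using hp) ?_ (hWo.preimage hc) ?_
    (hσ.comp (contDiff_id.add contDiff_const).contDiffOn fun x hx => hx)
    (fun x hx => hSσ _ hx) ?_).comp_sub⟩
  · exact (IsometryEquiv.addRight p).isometry.antilipschitz.isBounded_preimage hSb
  · rw [hcl]
    exact preimage_mono hSW
  · intro x hx
    rw [fderiv_comp_add_right]
    rw [hfr] at hx
    exact hσ' _ hx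

/-- A quartic perturbation of the first coordinate, vanishing to second order on `t = 0`. -/
def quarticPerturbation (ε A t u : ℝ) : ℝ := t + ε * (t ^ 2 * (u ^ 2 + A + A * t ^ 2))

theorem quarticPerturbation_sub (ε A t u T U : ℝ) :
    quarticPerturbation ε A T U - quarticPerturbation ε A t u =
      (1 + ε * (2 * t * (u ^ 2 + A) + 4 * A * t ^ 3)) * (T - t) + ε * (2 * t ^ 2 * u) * (U - u) +
      ε * (((U - u) * T + 2 * (T - t) * u) ^ 2 +
        (T - t) ^ 2 * (A * (1 + 3 * t ^ 2 + 2 * t * T + T ^ 2) - u ^ 2 - 2 * u * U)) := by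
  unfold quarticPerturbation
  ring

section

variable {C ε t u T U : ℝ}

theorem sq_le_of_abs_le_mul_add_two (hu : |u| ≤ C * (t + 2)) :
    u ^ 2 ≤ C ^ 2 * (t + 2) ^ 2 := by
  rw [← sq_abs, ← mul_pow]
  exact pow_le_pow_left₀ (abs_nonneg u) hu 2

theorem sq_le_of_abs_le_mul_add_two_of_nonpos (ht : -1 ≤ t) (ht0 : t ≤ 0)
    (hu : |u| ≤ C * (t + 2)) : u ^ 2 ≤ 4 * C ^ 2 := by
  have h1 := sq_le_of_abs_le_mul_add_two hu
  have h2 : (t + 2) ^ 2 ≤ 4 := by nlinarith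
  linarith [mul_le_mul_of_nonneg_left h2 (sq_nonneg C)]

theorem quarticPerturbation_remainder_pos (hu : |u| ≤ C * (t + 2))
    (hU : |U| ≤ C * (T + 2)) :
    0 < (24 * C ^ 2 + 1) * (1 + 3 * t ^ 2 + 2 * t * T + T ^ 2) - u ^ 2 - 2 * u * U := by
  have h1 := sq_le_of_abs_le_mul_add_two hu
  have h2 := sq_le_of_abs_le_mul_add_two hU
  have h3 : 0 ≤ C ^ 2 * (24 * (1 + 3 * t ^ 2 + 2 * t * T + T ^ 2) -
      (2 * (t + 2) ^ 2 + (T + 2) ^ 2)) := by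
    refine mul_nonneg (sq_nonneg C) ?_
    nlinarith [sq_nonneg (t - 2), sq_nonneg (T - 2), sq_nonneg (3 * t + 2 * T), sq_nonneg T,
      sq_nonneg t]
  nlinarith [sq_nonneg (u - U), sq_nonneg (t + T), sq_nonneg t]

theorem quarticPerturbation_slope_nonneg (hε : 0 ≤ ε) (hεC : ε * (152 * C ^ 2 + 6) ≤ 1)
    (ht : -1 ≤ t) (hu : |u| ≤ C * (t + 2)) :
    0 ≤ 1 + ε * (2 * t * (u ^ 2 + (24 * C ^ 2 + 1)) + 4 * (24 * C ^ 2 + 1) * t ^ 3) := by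
  rcases le_total 0 t with h | h
  · positivity
  · have h2 := sq_le_of_abs_le_mul_add_two_of_nonpos ht h hu
    have h3 : -(152 * C ^ 2 + 6) ≤
        2 * t * (u ^ 2 + (24 * C ^ 2 + 1)) + 4 * (24 * C ^ 2 + 1) * t ^ 3 := by
      have h4 : -(u ^ 2 + (24 * C ^ 2 + 1)) ≤ t * (u ^ 2 + (24 * C ^ 2 + 1)) := by
        nlinarith [sq_nonneg C, sq_nonneg u]
      have h5 : -1 ≤ t ^ 3 := by nlinarith [sq_nonneg t, sq_nonneg (t + 1)]
      nlinarith [sq_nonneg C]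
    nlinarith

theorem le_quarticPerturbation_sub (hε : 0 ≤ ε) (hu : |u| ≤ C * (t + 2))
    (hU : |U| ≤ C * (T + 2)) :
    (1 + ε * (2 * t * (u ^ 2 + (24 * C ^ 2 + 1)) + 4 * (24 * C ^ 2 + 1) * t ^ 3)) * (T - t) +
        ε * (2 * t ^ 2 * u) * (U - u) ≤
      quarticPerturbation ε (24 * C ^ 2 + 1) T U - quarticPerturbation ε (24 * C ^ 2 + 1) t u := by
  rw [quarticPerturbation_sub]
  have := (quarticPerturbation_remainder_pos hu hU).le
  refine le_add_of_nonneg_right ?_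
  positivity

theorem lt_quarticPerturbation_sub (hε : 0 < ε) (hu : |u| ≤ C * (t + 2))
    (hU : |U| ≤ C * (T + 2)) (hT0 : T ≠ 0) (huU : u ≠ U) :
    (1 + ε * (2 * t * (u ^ 2 + (24 * C ^ 2 + 1)) + 4 * (24 * C ^ 2 + 1) * t ^ 3)) * (T - t) +
        ε * (2 * t ^ 2 * u) * (U - u) <
      quarticPerturbation ε (24 * C ^ 2 + 1) T U - quarticPerturbation ε (24 * C ^ 2 + 1) t u := by
  rw [quarticPerturbation_sub]
  have hpos := quarticPerturbation_remainder_pos hu hU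
  refine lt_add_of_pos_right _ (mul_pos hε ?_)
  rcases eq_or_ne T t with rfl | hTt
  · have : (U - u) * T ≠ 0 := mul_ne_zero (sub_ne_zero.2 huU.symm) hT0
    have h : 0 < ((U - u) * T) ^ 2 := by positivity
    linarith
  · have : 0 < (T - t) ^ 2 := by
      have := sub_ne_zero.2 hTt
      positivity
    positivity

theorem quarticPerturbation_neg (hε : 0 ≤ ε) (hεC : ε * (152 * C ^ 2 + 6) ≤ 1)
    (ht : -1 ≤ t) (ht0 : t < 0) (hu : |u| ≤ C * (t + 2)) :
    quarticPerturbation ε (24 * C ^ 2 + 1) t u < 0 := by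
  have h2 := sq_le_of_abs_le_mul_add_two_of_nonpos ht ht0.le hu
  have h3 : t ^ 2 ≤ 1 := by nlinarith
  have h4 : u ^ 2 + (24 * C ^ 2 + 1) + (24 * C ^ 2 + 1) * t ^ 2 ≤ 52 * C ^ 2 + 2 := by
    nlinarith [sq_nonneg C]
  have h5 : ε * (u ^ 2 + (24 * C ^ 2 + 1) + (24 * C ^ 2 + 1) * t ^ 2) < 1 := by
    have h6 : 0 ≤ ε * C ^ 2 := by positivity
    rcases hε.eq_or_lt with rfl | h7
    · simp
    · nlinarith
  have h6 : quarticPerturbation ε (24 * C ^ 2 + 1) t u =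
      t * (1 + t * (ε * (u ^ 2 + (24 * C ^ 2 + 1) + (24 * C ^ 2 + 1) * t ^ 2))) := by
    unfold quarticPerturbation
    ring
  rw [h6]
  refine mul_neg_of_neg_of_pos ht0 ?_
  have h7 : 0 ≤ ε * (u ^ 2 + (24 * C ^ 2 + 1) + (24 * C ^ 2 + 1) * t ^ 2) := by positivity
  nlinarith

theorem quarticPerturbation_nonneg {A : ℝ} (hε : 0 ≤ ε) (hA : 0 ≤ A) (ht : 0 ≤ t) :
    0 ≤ quarticPerturbation ε A t u := by
  unfold quarticPerturbation
  positivity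

end

section

variable {E : Type*} [AddCommGroup E] [Module ℝ E] {C ε : ℝ} {t : E → ℝ} {l : E →ₗ[ℝ] ℝ}

theorem convexOn_quarticPerturbation (hε : 0 ≤ ε) (hεC : ε * (152 * C ^ 2 + 6) ≤ 1)
    (ht : ConvexOn ℝ univ t) (ht1 : ∀ x, -1 ≤ t x) (hl : ∀ x, |l x| ≤ C * (t x + 2)) :
    ConvexOn ℝ univ (fun x => quarticPerturbation ε (24 * C ^ 2 + 1) (t x) (l x)) := by
  refine ⟨convex_univ, fun x _ y _ a b ha hb hab => ?_⟩
  have hxy := ht.2 (mem_univ x) (mem_univ y) ha hb hab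
  set z := a • x + b • y with hz
  have hlz : l z = a * l x + b * l y := by simp [hz]
  have h1 := le_quarticPerturbation_sub hε (hl z) (hl x)
  have h2 := le_quarticPerturbation_sub hε (hl z) (hl y)
  have h3 := quarticPerturbation_slope_nonneg hε hεC (ht1 z) (hl z)
  simp only [smul_eq_mul] at hxy ⊢
  have h4 := mul_nonneg h3 (sub_nonneg.2 hxy)
  have h5 := add_le_add (mul_le_mul_of_nonneg_left h1 ha) (mul_le_mul_of_nonneg_left h2 hb)
  obtain rfl : b = 1 - a := by linarith
  generalize (1 + ε * (2 * t z * (l z ^ 2 + (24 * C ^ 2 + 1)) + 4 * (24 * C ^ 2 + 1) * t z ^ 3)) = p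
    at *
  generalize ε * (2 * t z ^ 2 * l z) = q at *
  generalize quarticPerturbation ε (24 * C ^ 2 + 1) (t z) (l z) = r at *
  rw [hlz] at h5
  linarith

theorem quarticPerturbation_convexCombo_lt (hε : 0 < ε) (hεC : ε * (152 * C ^ 2 + 6) ≤ 1)
    (ht : ConvexOn ℝ univ t) (ht1 : ∀ x, -1 ≤ t x) (hl : ∀ x, |l x| ≤ C * (t x + 2))
    {x y : E} {a b : ℝ} (hx : t x ≠ 0) (hlxy : l x ≠ l y) (ha : 0 < a) (hb : 0 < b)
    (hab : a + b = 1) :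
    quarticPerturbation ε (24 * C ^ 2 + 1) (t (a • x + b • y)) (l (a • x + b • y)) <
      a * quarticPerturbation ε (24 * C ^ 2 + 1) (t x) (l x) +
        b * quarticPerturbation ε (24 * C ^ 2 + 1) (t y) (l y) := by
  have hxy := ht.2 (mem_univ x) (mem_univ y) ha.le hb.le hab
  set z := a • x + b • y with hz
  have hlz : l z = a * l x + b * l y := by simp [hz]
  obtain rfl : b = 1 - a := by linarith
  have hlzx : l z ≠ l x := by
    intro h
    have : (1 - a) * (l x - l y) = 0 := by linarith
    exact (mul_ne_zero hb.ne' (sub_ne_zero.2 hlxy)) this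
  have h1 := lt_quarticPerturbation_sub hε (hl z) (hl x) hx hlzx
  have h2 := le_quarticPerturbation_sub hε.le (hl z) (hl y)
  have h3 := quarticPerturbation_slope_nonneg hε.le hεC (ht1 z) (hl z)
  simp only [smul_eq_mul] at hxy ⊢
  have h4 := mul_nonneg h3 (sub_nonneg.2 hxy)
  have h5 := add_lt_add_of_lt_of_le (mul_lt_mul_of_pos_left h1 ha)
    (mul_le_mul_of_nonneg_left h2 hb.le)
  generalize (1 + ε * (2 * t z * (l z ^ 2 + (24 * C ^ 2 + 1)) + 4 * (24 * C ^ 2 + 1) * t z ^ 3)) = p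
    at *
  generalize ε * (2 * t z ^ 2 * l z) = q at *
  generalize quarticPerturbation ε (24 * C ^ 2 + 1) (t z) (l z) = r at *
  rw [hlz] at h5
  linarith

end

/-- Theorem 7.1: a bounded convex domain in `ℝⁿ` with `C^k` boundary
(`k ≥ 1`) admits a global `C^k` defining function which is convex on `ℝⁿ` and strictly
convex near every point off the boundary. -/
theorem exists_strictly_convex_defining_function {n k : ℕ} (hk : 1 ≤ k)
    (Ω : Set (Fin n → ℝ)) (hΩ : IsOpen Ω) (hne : Ω.Nonempty)
    (hbd : Bornology.IsBounded Ω) (hconv : Convex ℝ Ω)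
    (hsmooth : ∃ (W : Set (Fin n → ℝ)) (σ : (Fin n → ℝ) → ℝ), IsOpen W ∧ closure Ω ⊆ W ∧
      ContDiffOn ℝ k σ W ∧ Ω = {x ∈ W | σ x < 0} ∧
      ∀ x ∈ frontier Ω, fderiv ℝ σ x ≠ 0) :
    ∃ ρ : (Fin n → ℝ) → ℝ, ContDiff ℝ k ρ ∧
      Ω = {x : Fin n → ℝ | ρ x < 0} ∧
      (∀ x ∈ frontier Ω, fderiv ℝ ρ x ≠ 0) ∧
      ConvexOn ℝ Set.univ ρ ∧
      ∀ x : Fin n → ℝ, x ∉ frontier Ω →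
        ∃ ε : ℝ, 0 < ε ∧ StrictConvexOn ℝ (Metric.ball x ε) ρ := by
  obtain ⟨W, σ, hWo, hSW, hσ, hΩσ, hσ'⟩ := hsmooth
  obtain ⟨t, ht⟩ := exists_isProperConvexDefiningFunction (Nat.one_le_iff_ne_zero.1 hk) hΩ hconv
    hne hbd hWo hSW hσ (fun x hx => by rw [hΩσ]; simp [hx]) hσ'
  obtain ⟨C, hC, hgrow⟩ := ht.exists_norm_le
  set A := 24 * C ^ 2 + 1 with hA
  set ε := (152 * C ^ 2 + 6)⁻¹ with hεdef
  have hε : 0 < ε := by positivity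
  have hεC : ε * (152 * C ^ 2 + 6) ≤ 1 := (inv_mul_cancel₀ (by positivity)).le
  have hA0 : 0 ≤ A := by positivity
  have hcoord : ∀ (i : Fin n) (x : Fin n → ℝ),
      |(LinearMap.proj i : (Fin n → ℝ) →ₗ[ℝ] ℝ) x| ≤ C * (t x + 2) := fun i x =>
    (norm_le_pi_norm x i).trans (hgrow x)
  let F : Fin n → (Fin n → ℝ) → ℝ := fun i x =>
    quarticPerturbation ε A (t x) ((LinearMap.proj i : (Fin n → ℝ) →ₗ[ℝ] ℝ) x)
  let ρ : (Fin n → ℝ) → ℝ := fun x => t x + ∑ i, F i x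
  have hF : ∀ i, ConvexOn ℝ univ (F i) := fun i =>
    convexOn_quarticPerturbation hε.le hεC ht.convexOn ht.neg_one_le (hcoord i)
  have hρc : ContDiff ℝ k ρ := by
    have := ht.contDiff
    refine this.add (ContDiff.sum fun i _ => ?_)
    simp only [F, quarticPerturbation, LinearMap.proj_apply]
    fun_prop
  have hρneg : ∀ x, t x < 0 → ρ x < 0 := fun x hx =>
    add_neg_of_neg_of_nonpos hx (Finset.sum_nonpos fun i _ =>
      (quarticPerturbation_neg hε.le hεC (ht.neg_one_le x) hx (hcoord i x)).le)
  have hρpos : ∀ x, 0 ≤ t x → 0 ≤ ρ x := fun x hx =>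
    add_nonneg hx (Finset.sum_nonneg fun i _ => quarticPerturbation_nonneg hε.le hA0 hx)
  have hρconv : ConvexOn ℝ univ ρ := by
    refine ht.convexOn.add ⟨convex_univ, fun x _ y _ a b ha hb hab => ?_⟩
    rw [smul_eq_mul, smul_eq_mul, Finset.mul_sum, Finset.mul_sum, ← Finset.sum_add_distrib]
    exact Finset.sum_le_sum fun i _ => (hF i).2 (mem_univ x) (mem_univ y) ha hb hab
  refine ⟨ρ, hρc, ?_, ?_, hρconv, ?_⟩
  · ext x
    rw [← ht.neg_iff]
    exact ⟨hρneg x, fun h => not_le.1 fun h' => absurd (hρpos x h') (not_le.2 h)⟩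
  · intro y hy h0
    obtain ⟨w, hw⟩ := hne
    have hk0 : (k : WithTop ℕ∞) ≠ 0 := by exact_mod_cast Nat.one_le_iff_ne_zero.1 hk
    have hd := (hρc.differentiable hk0 y).hasFDerivAt
    have h1 := hρconv.hasFDerivAt_apply_sub_le hd w
    rw [h0, _root_.zero_apply] at h1
    have h2 := hρneg w ((ht.neg_iff w).2 hw)
    have h3 : 0 ≤ ρ y := hρpos y (not_lt.1 fun h => by
      rw [hΩ.frontier_eq] at hy
      exact hy.2 ((ht.neg_iff y).1 h))
    linarith
  · intro x hx
    have hx0 : t x ≠ 0 := fun h => hx (ht.mem_frontier x h)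
    obtain ⟨r, hr, hball⟩ := Metric.eventually_nhds_iff_ball.1
      (ht.contDiff.continuous.continuousAt.eventually_ne hx0)
    refine ⟨r, hr, convex_ball x r, fun y hy z hz hyz a b ha hb hab => ?_⟩
    obtain ⟨i, hi⟩ := Function.ne_iff.1 hyz
    have h1 := ht.convexOn.2 (mem_univ y) (mem_univ z) ha.le hb.le hab
    have h2 : ∑ i, F i (a • y + b • z) < ∑ i, (a * F i y + b * F i z) :=
      Finset.sum_lt_sum (fun j _ => (hF j).2 (mem_univ y) (mem_univ z) ha.le hb.le hab)
        ⟨i, Finset.mem_univ i, quarticPerturbation_convexCombo_lt hε hεC ht.convexOn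
          ht.neg_one_le (hcoord i) (hball y hy) hi ha hb hab⟩
    rw [Finset.sum_add_distrib, ← Finset.mul_sum, ← Finset.mul_sum] at h2
    simp only [ρ, smul_eq_mul] at h1 ⊢
    linarith
end

section
/- Let Ω ⊂⊂ ℂⁿ (n ≥ 2) be a bounded convex domain with smooth boundary. Then DF(Ω) = 1 and S(Ω) = 1. -/
noncomputable section

open Complex Topology
open scoped ENNReal

/-- Wirtinger derivative `∂f/∂z_j`. -/
def dz {n : ℕ} (j : Fin n) (f : (Fin n → ℂ) → ℂ) (z : Fin n → ℂ) : ℂ :=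
  (fderiv ℝ f z (Pi.single j 1) - Complex.I * fderiv ℝ f z (Pi.single j Complex.I)) / 2

/-- Wirtinger derivative `∂f/∂z̄_j`. -/
def dzbar {n : ℕ} (j : Fin n) (f : (Fin n → ℂ) → ℂ) (z : Fin n → ℂ) : ℂ :=
  (fderiv ℝ f z (Pi.single j 1) + Complex.I * fderiv ℝ f z (Pi.single j Complex.I)) / 2

/-- Complexification of a real-valued function. -/
def cplx {n : ℕ} (ρ : (Fin n → ℂ) → ℝ) : (Fin n → ℂ) → ℂ := fun z => (ρ z : ℂ)

/-- The Levi form `L_ρ(X,Y)(z) = Σ_{j,k} ∂²ρ/∂z_j∂z̄_k (z) X_j conj(Y_k)`. -/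
def levi {n : ℕ} (ρ : (Fin n → ℂ) → ℝ) (X Y : Fin n → ℂ) (z : Fin n → ℂ) : ℂ :=
  ∑ j, ∑ k, dz j (fun w => dzbar k (cplx ρ) w) z * X j * (starRingEnd ℂ) (Y k)

/-- `Xf = Σ_j X_j ∂f/∂z_j` for a (1,0) vector `X`. -/
def dirDeriv {n : ℕ} (X : Fin n → ℂ) (f : (Fin n → ℂ) → ℂ) (z : Fin n → ℂ) : ℂ :=
  ∑ j, X j * dz j f z

/-- `X̄f = Σ_j conj(X_j) ∂f/∂z̄_j`. -/
def dirDerivBar {n : ℕ} (X : Fin n → ℂ) (f : (Fin n → ℂ) → ℂ) (z : Fin n → ℂ) : ℂ :=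
  ∑ j, (starRingEnd ℂ) (X j) * dzbar j f z

/-- Derivative of `f` along the (1,0) vector field `X`. -/
def fieldDeriv {n : ℕ} (X : (Fin n → ℂ) → (Fin n → ℂ)) (f : (Fin n → ℂ) → ℂ)
    (z : Fin n → ℂ) : ℂ :=
  dirDeriv (X z) f z

/-- Euclidean norm of the real gradient of `ρ`. -/
def gradNorm {n : ℕ} (ρ : (Fin n → ℂ) → ℝ) (z : Fin n → ℂ) : ℝ :=
  Real.sqrt (∑ j, ((fderiv ℝ ρ z (Pi.single j 1)) ^ 2 +
    (fderiv ℝ ρ z (Pi.single j Complex.I)) ^ 2))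

/-- The complex normal field `N_ρ`. -/
def nfield {n : ℕ} (ρ : (Fin n → ℂ) → ℝ) (z : Fin n → ℂ) : Fin n → ℂ := fun j =>
  ((Real.sqrt (∑ k, Complex.normSq (dz k (cplx ρ) z)) : ℝ) : ℂ)⁻¹ * dzbar j (cplx ρ) z

/-- Squared Euclidean norm of a vector in ℂⁿ. -/
def enormSq {n : ℕ} (X : Fin n → ℂ) : ℝ := ∑ j, Complex.normSq (X j)

/-- `f` is strictly plurisubharmonic on `S`. -/
def StrictPSHOn {n : ℕ} (f : (Fin n → ℂ) → ℝ) (S : Set (Fin n → ℂ)) : Prop :=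
  ∀ z ∈ S, ∀ X : Fin n → ℂ, X ≠ 0 → 0 < (levi f X X z).re

/-- `ρ` is a (global smooth) defining function of `Ω` on the neighborhood `V` of `cl Ω`. -/
structure IsDefFn {n : ℕ} (Ω V : Set (Fin n → ℂ)) (ρ : (Fin n → ℂ) → ℝ) : Prop where
  isOpen : IsOpen V
  subset : closure Ω ⊆ V
  smooth : ContDiffOn ℝ (⊤ : ℕ∞) ρ V
  eq : Ω = {z ∈ V | ρ z < 0}
  grad_ne : ∀ z ∈ frontier Ω, fderiv ℝ ρ z ≠ 0

/-- The Levi form of `ρ` is positive semidefinite on complex tangent vectors at `z`. -/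
def LeviPseudoconvexAt {n : ℕ} (ρ : (Fin n → ℂ) → ℝ) (z : Fin n → ℂ) : Prop :=
  ∀ X : Fin n → ℂ, dirDeriv X (cplx ρ) z = 0 → 0 ≤ (levi ρ X X z).re

/-- `Ω` is a (smoothly bounded, Levi) pseudoconvex domain. -/
def IsPseudoconvex {n : ℕ} (Ω : Set (Fin n → ℂ)) : Prop :=
  ∃ (V : Set (Fin n → ℂ)) (ρ : (Fin n → ℂ) → ℝ), IsDefFn Ω V ρ ∧
    ∀ p ∈ frontier Ω, LeviPseudoconvexAt ρ p

/-- The set of Steinness exponents of `ρ`. -/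
def steinExpSet {n : ℕ} (Ω : Set (Fin n → ℂ)) (ρ : (Fin n → ℂ) → ℝ) : Set ℝ :=
  {η : ℝ | 1 < η ∧ ∃ W : Set (Fin n → ℂ), IsOpen W ∧ frontier Ω ⊆ W ∧
    StrictPSHOn (fun z => ρ z ^ η) ((closure Ω)ᶜ ∩ W)}

/-- The Steinness exponent `η̃_ρ` of a defining function `ρ` (`∞` if none exists). -/
def steinExp {n : ℕ} (Ω : Set (Fin n → ℂ)) (ρ : (Fin n → ℂ) → ℝ) : ℝ≥0∞ :=
  sInf (ENNReal.ofReal '' steinExpSet Ω ρ)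

/-- The Steinness index `S(Ω)`. -/
def steinIndex {n : ℕ} (Ω : Set (Fin n → ℂ)) : ℝ≥0∞ :=
  ⨅ (V : Set (Fin n → ℂ)) (ρ : (Fin n → ℂ) → ℝ) (_ : IsDefFn Ω V ρ), steinExp Ω ρ

/-- The set of Diederich–Fornæss exponents of `ρ`. -/
def dfExpSet {n : ℕ} (Ω : Set (Fin n → ℂ)) (ρ : (Fin n → ℂ) → ℝ) : Set ℝ :=
  {η : ℝ | 0 < η ∧ η < 1 ∧ StrictPSHOn (fun z => -((-ρ z) ^ η)) Ω}

/-- The Diederich–Fornæss exponent of `ρ` (`0` if no exponent exists). -/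
def dfExp {n : ℕ} (Ω : Set (Fin n → ℂ)) (ρ : (Fin n → ℂ) → ℝ) : ℝ :=
  sSup (insert 0 (dfExpSet Ω ρ))

/-- The Diederich–Fornæss index `DF(Ω)`. -/
def dfIndex {n : ℕ} (Ω : Set (Fin n → ℂ)) : ℝ :=
  sSup {t : ℝ | ∃ V ρ, IsDefFn Ω V ρ ∧ t = dfExp Ω ρ}

/-- `L` is a smooth (1,0) tangent vector field for `ρ` on `A`. -/
def IsTangentField {n : ℕ} (ρ : (Fin n → ℂ) → ℝ) (L : (Fin n → ℂ) → (Fin n → ℂ))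
    (A : Set (Fin n → ℂ)) : Prop :=
  ContDiffOn ℝ (⊤ : ℕ∞) L A ∧ ∀ z ∈ A, dirDeriv (L z) (cplx ρ) z = 0

/-- The key differential inequality
`(1/(η₂−1))|L_ρ(L,N)|²/‖∇ρ‖² − (1/2)(N L_ρ(L,L))/‖∇ρ‖ ≤ 0` at `p`. -/
def keyIneqAt {n : ℕ} (ρ : (Fin n → ℂ) → ℝ) (L : (Fin n → ℂ) → (Fin n → ℂ)) (η₂ : ℝ)
    (p : Fin n → ℂ) : Prop :=
  1 / (η₂ - 1) * Complex.normSq (levi ρ (L p) (nfield ρ p) p) / (gradNorm ρ p) ^ 2 -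
    1 / 2 * (fieldDeriv (nfield ρ) (fun w => levi ρ (L w) (L w) w) p).re / gradNorm ρ p ≤ 0

/-- The strict version of the key differential inequality. -/
def strictKeyIneqAt {n : ℕ} (ρ : (Fin n → ℂ) → ℝ) (L : (Fin n → ℂ) → (Fin n → ℂ)) (η₂ : ℝ)
    (p : Fin n → ℂ) : Prop :=
  1 / (η₂ - 1) * Complex.normSq (levi ρ (L p) (nfield ρ p) p) / (gradNorm ρ p) ^ 2 -
    1 / 2 * (fieldDeriv (nfield ρ) (fun w => levi ρ (L w) (L w) w) p).re / gradNorm ρ p < 0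

/-- `cl Ω` has a strong Stein neighborhood basis. -/
def HasStrongSteinBasis {n : ℕ} (Ω : Set (Fin n → ℂ)) : Prop :=
  ∃ (V : Set (Fin n → ℂ)) (ρ : (Fin n → ℂ) → ℝ), IsDefFn Ω V ρ ∧ ∃ ε₀ : ℝ, 0 < ε₀ ∧
    (∀ z ∈ V, 0 ≤ ρ z → ρ z < ε₀ → fderiv ℝ ρ z ≠ 0) ∧
    ∀ ε : ℝ, 0 ≤ ε → ε < ε₀ → ∀ z ∈ V, ρ z = ε → LeviPseudoconvexAt ρ z

/-- Vanishing order at `0` of a holomorphic function `ℂ → ℂ` (`∞` if all derivatives vanish). -/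
def orderC (h : ℂ → ℂ) : ℕ∞ :=
  sInf ((fun k : ℕ => (k : ℕ∞)) '' {k : ℕ | iteratedDeriv k h 0 ≠ 0})

/-- Vanishing order at `0` of a real-valued function on `ℂ`. -/
def orderR (g : ℂ → ℝ) : ℕ∞ :=
  sInf ((fun k : ℕ => (k : ℕ∞)) '' {k : ℕ | iteratedFDeriv ℝ k g 0 ≠ 0})

/-- `ν(γ)`: minimal vanishing order at `0` of the components of `γ − p`. -/
def curveOrder {n : ℕ} (γ : ℂ → Fin n → ℂ) (p : Fin n → ℂ) : ℕ∞ :=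
  ⨅ j, orderC (fun t => γ t j - p j)

/-- `p` is a boundary point of finite D'Angelo 1-type (w.r.t. the defining function `ρ`). -/
def FiniteTypePt {n : ℕ} (ρ : (Fin n → ℂ) → ℝ) (p : Fin n → ℂ) : Prop :=
  ∃ M : ℕ, ∀ γ : ℂ → Fin n → ℂ, (∀ j, AnalyticAt ℂ (fun t => γ t j) 0) → γ 0 = p →
    ¬ (∀ᶠ t in nhds (0 : ℂ), γ t = p) →
    orderR (fun t => ρ (γ t)) ≤ (M : ℕ∞) * curveOrder γ p

/-- The gauge of a bounded convex domain with smooth boundary is smooth away from the origin. -/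
theorem contDiffAt_gauge_s18 {E : Type*} [NormedAddCommGroup E] [NormedSpace ℝ E] [CompleteSpace E]
    {Ω V : Set E} {ρ : E → ℝ} (hΩ : IsOpen Ω) (h0 : (0 : E) ∈ Ω)
    (hbd : Bornology.IsBounded Ω) (hconv : Convex ℝ Ω) (hV : IsOpen V) (hsub : closure Ω ⊆ V)
    (hρ : ContDiffOn ℝ (⊤ : ℕ∞) ρ V) (heq : Ω = {z ∈ V | ρ z < 0})
    (hgrad : ∀ z ∈ frontier Ω, fderiv ℝ ρ z ≠ 0) {z : E} (hz : z ≠ 0) :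
    ContDiffAt ℝ (⊤ : ℕ∞) (gauge Ω) z := by
  have hnhds : Ω ∈ 𝓝 (0 : E) := hΩ.mem_nhds h0
  have habs : Absorbent ℝ Ω := absorbent_nhds_zero hnhds
  have hcont : Continuous (gauge Ω) := continuous_gauge hconv hnhds
  have hpos : ∀ w : E, w ≠ 0 → 0 < gauge Ω w := fun w hw =>
    (gauge_pos habs (NormedSpace.isVonNBounded_of_isBounded ℝ hbd)).2 hw
  have hfront : ∀ w : E, w ≠ 0 → (gauge Ω w)⁻¹ • w ∈ frontier Ω := by
    intro w hw
    rw [← gauge_eq_one_iff_mem_frontier hconv hnhds,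
      gauge_smul_of_nonneg (inv_nonneg.2 (hpos w hw).le), smul_eq_mul,
      inv_mul_cancel₀ (hpos w hw).ne']
  have hin : ∀ w : E, gauge Ω w < 1 → w ∈ Ω := fun w hw => by
    rwa [gauge_lt_one_iff_mem_interior hconv hnhds, hΩ.interior_eq] at hw
  have hfV : ∀ w ∈ frontier Ω, w ∈ V := fun w hw => hsub (frontier_subset_closure hw)
  have hsm : ∀ w ∈ frontier Ω, ContDiffAt ℝ (⊤ : ℕ∞) ρ w := fun w hw =>
    hρ.contDiffAt (hV.mem_nhds (hfV w hw))
  have hzero : ∀ w ∈ frontier Ω, ρ w = 0 := by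
    intro w hw
    apply le_antisymm
    · have hcl := frontier_subset_closure hw
      refine ContinuousWithinAt.closure_le hcl (hsm w hw).continuousAt.continuousWithinAt
        continuousWithinAt_const fun y hy => ?_
      rw [heq] at hy
      exact hy.2.le
    · by_contra! hneg
      have : w ∈ Ω := by rw [heq]; exact ⟨hfV w hw, hneg⟩
      rw [hΩ.frontier_eq] at hw
      exact hw.2 this
  -- the radial derivative of `ρ` is positive on the boundary
  have hrad : ∀ p ∈ frontier Ω, 0 < fderiv ℝ ρ p p := by
    intro p hp
    have hd : HasFDerivAt ρ (fderiv ℝ ρ p) p :=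
      ((hsm p hp).differentiableAt (by simp)).hasFDerivAt
    have key : ∀ w ∈ Ω, fderiv ℝ ρ p w ≤ fderiv ℝ ρ p p := by
      intro w hw
      have hmax : IsLocalMaxOn ρ (closure Ω) p := by
        filter_upwards [self_mem_nhdsWithin] with y hy
        rw [hzero p hp]
        by_cases hyΩ : y ∈ Ω
        · rw [heq] at hyΩ
          exact hyΩ.2.le
        · exact (hzero y ⟨hy, by rwa [hΩ.interior_eq]⟩).le
      have hcone : w - p ∈ posTangentConeAt (closure Ω) p :=
        sub_mem_posTangentConeAt_of_segment_subset
          (hconv.closure.segment_subset (frontier_subset_closure hp) (subset_closure hw))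
      have := hmax.hasFDerivWithinAt_nonpos hd.hasFDerivWithinAt hcone
      rw [map_sub] at this
      linarith
    by_contra! hle
    refine hgrad p hp ?_
    have hle0 : ∀ w ∈ Ω, fderiv ℝ ρ p w ≤ 0 := fun w hw => (key w hw).trans hle
    have hall : ∀ v : E, fderiv ℝ ρ p v ≤ 0 := by
      intro v
      have hgv : 0 < gauge Ω v + 1 := by linarith [gauge_nonneg (s := Ω) v]
      have hmem : (gauge Ω v + 1)⁻¹ • v ∈ Ω := by
        refine hin _ ?_
        rw [gauge_smul_of_nonneg (inv_nonneg.2 hgv.le), smul_eq_mul, inv_mul_lt_iff₀ hgv]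
        linarith
      have := hle0 _ hmem
      rw [map_smul, smul_eq_mul] at this
      by_contra! hv
      exact absurd this (not_le.2 (mul_pos (inv_pos.2 hgv) hv))
    ext v
    have h1 := hall v
    have h2 := hall (-v)
    rw [map_neg] at h2
    rw [_root_.zero_apply]
    linarith
  -- `s = (gauge Ω w)⁻¹` solves `ρ (s • w) = 0`
  set s : ℝ := (gauge Ω z)⁻¹ with hs
  have hspos : 0 < s := inv_pos.2 (hpos z hz)
  have hpz : s • z ∈ frontier Ω := hfront z hz
  set F : E × ℝ → ℝ := fun x => ρ (x.2 • x.1) with hF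
  have hFsm : ContDiffAt ℝ (⊤ : ℕ∞) F (z, s) :=
    ContDiffAt.comp (z, s) (g := ρ) (f := fun x : E × ℝ => x.2 • x.1) (hsm _ hpz)
      (contDiffAt_snd.smul contDiffAt_fst)
  have hFz : F (z, s) = 0 := hzero _ hpz
  have htop : ((⊤ : ℕ∞) : WithTop ℕ∞) ≠ 0 := by simp
  have hpart : fderiv ℝ F (z, s) ((0 : E), (1 : ℝ)) = fderiv ℝ ρ (s • z) z := by
    have h1 : HasFDerivAt F (fderiv ℝ F (z, s)) (z, s) :=
      (hFsm.differentiableAt htop).hasFDerivAt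
    have h2 : HasDerivAt (fun t : ℝ => ((z, t) : E × ℝ)) ((0 : E), (1 : ℝ)) s :=
      (hasDerivAt_const s z).prodMk (hasDerivAt_id s)
    have h3 : HasDerivAt (fun t : ℝ => F (z, t)) _ s := h1.comp_hasDerivAt s h2
    have h4 : HasDerivAt (fun t : ℝ => t • z) z s := by
      simpa using (hasDerivAt_id s).smul_const z
    have h5 : HasDerivAt (fun t : ℝ => F (z, t)) _ s :=
      (((hsm _ hpz).differentiableAt htop).hasFDerivAt).comp_hasDerivAt s h4
    exact h3.unique h5
  have hne : fderiv ℝ ρ (s • z) z ≠ 0 := by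
    have := hrad _ hpz
    rw [map_smul, smul_eq_mul] at this
    exact (pos_of_mul_pos_right this hspos.le).ne'
  have hinv : (fderiv ℝ F (z, s) ∘L ContinuousLinearMap.inr ℝ E ℝ).IsInvertible := by
    refine ⟨ContinuousLinearEquiv.unitsEquivAut ℝ (Units.mk0 _ hne), ?_⟩
    ext
    simp [hpart]
  have himp := ContDiffAt.contDiffAt_implicitFunction hFsm htop hinv
  have htend : Filter.Tendsto (fun w : E => (w, (gauge Ω w)⁻¹)) (𝓝 z) (𝓝 (z, s)) :=
    (continuousAt_id.prodMk (hcont.continuousAt.inv₀ (hpos z hz).ne')).tendsto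
  have hev := htend.eventually
    (ContDiffAt.eventually_apply_eq_iff_implicitFunction hFsm htop hinv)
  have heqf : (fun w => (gauge Ω w)⁻¹) =ᶠ[𝓝 z] hFsm.implicitFunction htop hinv := by
    filter_upwards [hev, isOpen_ne.mem_nhds hz] with w hw hw0
    refine (hw.1 ?_).symm
    rw [hFz]
    exact hzero _ (hfront w hw0)
  have hfin := (himp.congr_of_eventuallyEq heqf).inv hspos.ne'
  have hid : gauge Ω = (fun w => (gauge Ω w)⁻¹)⁻¹ := by
    ext w
    simp
  rwa [hid]

/-- A smooth nondecreasing convex function on the line, constant near `0` and vanishing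
precisely at `1`. -/
theorem exists_convex_cutoff : ∃ χ : ℝ → ℝ, ContDiff ℝ (⊤ : ℕ∞) χ ∧ Monotone χ ∧
    ConvexOn ℝ Set.univ χ ∧ (∀ t ≤ 1 / 2, χ t = χ (1 / 2)) ∧ (∀ t, χ t < 0 ↔ t < 1) ∧
    ∀ t, χ t ≤ 0 ↔ t ≤ 1 := by
  set σ : ℝ → ℝ := fun t => Real.smoothTransition (2 * t - 1) with hσ
  have hσc : ContDiff ℝ (⊤ : ℕ∞) σ :=
    Real.smoothTransition.contDiff.comp ((contDiff_const.mul contDiff_id).sub contDiff_const)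
  have hσm : Monotone σ := fun a b hab => Real.smoothTransition.monotone (by linarith)
  set χ : ℝ → ℝ := fun t => ∫ x in (1 : ℝ)..t, σ x with hχ
  have hd : ∀ t, HasDerivAt χ (σ t) t := fun t =>
    intervalIntegral.integral_hasDerivAt_right (hσc.continuous.intervalIntegrable _ _)
      (hσc.continuous.stronglyMeasurableAtFilter _ _) hσc.continuous.continuousAt
  have hdiff : Differentiable ℝ χ := fun t => (hd t).differentiableAt
  have hderiv : deriv χ = σ := funext fun t => (hd t).deriv
  have hmono : Monotone χ := monotone_of_deriv_nonneg hdiff fun t => by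
    rw [hderiv]; exact Real.smoothTransition.nonneg _
  have hχ1 : χ 1 = 0 := intervalIntegral.integral_same
  have hstrict : StrictMonoOn χ (Set.Ici (1 / 2)) :=
    strictMonoOn_of_deriv_pos (convex_Ici _) hdiff.continuous.continuousOn fun t ht => by
      rw [interior_Ici, Set.mem_Ioi] at ht
      rw [hderiv]
      exact Real.smoothTransition.pos_of_pos (by linarith)
  have hneg : ∀ t < 1, χ t < 0 := fun t ht => by
    have h1 : χ t ≤ χ (max t (1 / 2)) := hmono (le_max_left _ _)
    have h2 : χ (max t (1 / 2)) < χ 1 :=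
      hstrict (Set.mem_Ici.2 (le_max_right _ _)) (by norm_num) (max_lt ht (by norm_num))
    linarith
  have hposi : ∀ t, 1 < t → 0 < χ t := fun t ht => by
    rw [← hχ1]
    exact hstrict (by norm_num) (Set.mem_Ici.2 (by linarith)) ht
  refine ⟨χ, contDiff_infty_iff_deriv.2 ⟨hdiff, hderiv ▸ hσc⟩, hmono,
    MonotoneOn.convexOn_of_deriv convex_univ hdiff.continuous.continuousOn
      hdiff.differentiableOn (hderiv ▸ hσm.monotoneOn _), ?_, ?_, ?_⟩
  · intro t ht
    have hanti : AntitoneOn χ (Set.Iic (1 / 2)) :=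
      antitoneOn_of_deriv_nonpos (convex_Iic _) hdiff.continuous.continuousOn
        hdiff.differentiableOn fun x hx => by
          rw [interior_Iic, Set.mem_Iio] at hx
          rw [hderiv]
          exact (Real.smoothTransition.zero_of_nonpos (by linarith)).le
    exact le_antisymm (hmono ht) (hanti ht (Set.mem_Iic.2 le_rfl) ht)
  · intro t
    refine ⟨fun h => ?_, hneg t⟩
    by_contra! h1
    have := hmono h1
    linarith
  · intro t
    refine ⟨fun h => ?_, fun h => hχ1 ▸ hmono h⟩
    by_contra! h1
    exact absurd h (not_le.2 (hposi t h1))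

/-- A bounded convex domain with smooth boundary has a smooth convex global defining function. -/
theorem exists_convexOn_defining {E : Type*} [NormedAddCommGroup E] [NormedSpace ℝ E]
    [CompleteSpace E] {Ω V : Set E} {ρ : E → ℝ} (hΩ : IsOpen Ω) (hne : Ω.Nonempty)
    (hbd : Bornology.IsBounded Ω) (hconv : Convex ℝ Ω) (hV : IsOpen V) (hsub : closure Ω ⊆ V)
    (hρ : ContDiffOn ℝ (⊤ : ℕ∞) ρ V) (heq : Ω = {z ∈ V | ρ z < 0})
    (hgrad : ∀ z ∈ frontier Ω, fderiv ℝ ρ z ≠ 0) :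
    ∃ r : E → ℝ, ContDiff ℝ (⊤ : ℕ∞) r ∧ ConvexOn ℝ Set.univ r ∧
      (∀ z, z ∈ Ω ↔ r z < 0) ∧ ∀ z, z ∈ closure Ω ↔ r z ≤ 0 := by
  obtain ⟨x₀, hx₀⟩ := hne
  obtain ⟨χ, hχs, hχm, hχc, hχ0, hχlt, hχle⟩ := exists_convex_cutoff
  set T : E ≃ₜ E := Homeomorph.addRight x₀ with hT
  have hTa : ∀ z, T z = z + x₀ := fun z => rfl
  set Ω' : Set E := T ⁻¹' Ω with hΩ'
  have hΩ'o : IsOpen Ω' := hΩ.preimage T.continuous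
  have h0 : (0 : E) ∈ Ω' := by
    rw [hΩ', Set.mem_preimage, hTa, zero_add]
    exact hx₀
  have hΩ'c : Convex ℝ Ω' := hconv.translate_preimage_left x₀
  have hbd' : Bornology.IsBounded Ω' := by
    obtain ⟨R, hR⟩ := hbd.exists_norm_le
    refine isBounded_iff_forall_norm_le.2 ⟨R + ‖x₀‖, fun z hz => ?_⟩
    have h1 := hR _ hz
    have h2 := norm_sub_le (z + x₀) x₀
    rw [add_sub_cancel_right] at h2
    rw [hTa] at h1
    linarith
  have hcl : closure Ω' = T ⁻¹' closure Ω := (T.preimage_closure Ω).symm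
  have hfr : frontier Ω' = T ⁻¹' frontier Ω := (T.preimage_frontier Ω).symm
  have hnhds : Ω' ∈ 𝓝 (0 : E) := hΩ'o.mem_nhds h0
  have hgs : ∀ z : E, z ≠ 0 → ContDiffAt ℝ (⊤ : ℕ∞) (gauge Ω') z := fun z hz =>
    contDiffAt_gauge_s18 (V := T ⁻¹' V) (ρ := fun w => ρ (w + x₀)) hΩ'o h0 hbd' hΩ'c
      (hV.preimage T.continuous) (hcl ▸ Set.preimage_mono hsub)
      (hρ.comp (contDiff_id.add contDiff_const).contDiffOn fun w hw => hw)
      (by rw [hΩ', heq]; rfl)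
      (fun w hw => by
        rw [fderiv_comp_add_right]
        rw [hfr] at hw
        exact hgrad _ hw) hz
  have hgc : Continuous (gauge Ω') := continuous_gauge hΩ'c hnhds
  have hconvg : ConvexOn ℝ Set.univ (gauge Ω') := by
    refine ⟨convex_univ, fun x _ y _ a b ha hb _ => ?_⟩
    refine (gauge_add_le hΩ'c (absorbent_nhds_zero hnhds) _ _).trans_eq ?_
    rw [gauge_smul_of_nonneg ha, gauge_smul_of_nonneg hb]
  have hsm : ContDiff ℝ (⊤ : ℕ∞) (χ ∘ gauge Ω') := by
    rw [contDiff_iff_contDiffAt]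
    intro z
    by_cases hz : z = 0
    · have hev : (χ ∘ gauge Ω') =ᶠ[𝓝 z] fun _ => χ (1 / 2) := by
        have : ∀ᶠ w in 𝓝 z, gauge Ω' w < 1 / 2 := by
          refine hgc.continuousAt.eventually_lt continuousAt_const ?_
          rw [hz, gauge_zero]
          norm_num
        filter_upwards [this] with w hw
        exact hχ0 _ hw.le
      exact contDiffAt_const.congr_of_eventuallyEq hev
    · exact hχs.contDiffAt.comp z (hgs z hz)
  have hconvr : ConvexOn ℝ Set.univ (χ ∘ gauge Ω') :=
    (hχc.subset (Set.subset_univ _) (by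
      rw [Set.image_univ]
      exact (isPreconnected_range hgc).ordConnected.convex)).comp hconvg (hχm.monotoneOn _)
  refine ⟨fun z => (χ ∘ gauge Ω') (z - x₀), hsm.comp (contDiff_id.sub contDiff_const), ?_, ?_, ?_⟩
  · simpa [sub_eq_add_neg, Function.comp_def] using hconvr.translate_left (-x₀)
  · intro z
    beta_reduce
    rw [Function.comp_apply, hχlt, gauge_lt_one_iff_mem_interior hΩ'c hnhds, hΩ'o.interior_eq,
      hΩ', Set.mem_preimage, hTa, sub_add_cancel]
  · intro z
    beta_reduce
    rw [Function.comp_apply, hχle, gauge_le_one_iff_mem_closure hΩ'c hnhds, hcl,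
      Set.mem_preimage, hTa, sub_add_cancel]

/-- Second derivative of `(v e^p) ^ α` for functions of one real variable. -/
theorem deriv_deriv_mul_exp_rpow {v p : ℝ → ℝ} (hv : ContDiff ℝ 2 v) (hp : ContDiff ℝ 2 p)
    (h0 : 0 < v 0) (α : ℝ) :
    deriv (deriv fun t => (v t * Real.exp (p t)) ^ α) 0 =
      α * (v 0 * Real.exp (p 0)) ^ (α - 2) * Real.exp (p 0) ^ 2 *
        (v 0 * deriv (deriv v) 0 - deriv v 0 ^ 2 + v 0 ^ 2 * deriv (deriv p) 0 +
          α * (deriv v 0 + v 0 * deriv p 0) ^ 2) := by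
  have hv1 : ∀ t, HasDerivAt v (deriv v t) t := fun t =>
    (hv.differentiable (by norm_num) t).hasDerivAt
  have hp1 : ∀ t, HasDerivAt p (deriv p t) t := fun t =>
    (hp.differentiable (by norm_num) t).hasDerivAt
  have hv2 : HasDerivAt (deriv v) (deriv (deriv v) 0) 0 :=
    ((hv.differentiable_deriv_two) 0).hasDerivAt
  have hp2 : HasDerivAt (deriv p) (deriv (deriv p) 0) 0 :=
    ((hp.differentiable_deriv_two) 0).hasDerivAt
  have hh : ∀ t, HasDerivAt (fun t => v t * Real.exp (p t))
      ((deriv v t + v t * deriv p t) * Real.exp (p t)) t := fun t =>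
    ((hv1 t).mul (hp1 t).exp).congr_deriv (by ring)
  have hev : ∀ᶠ t in 𝓝 (0 : ℝ), 0 < v t :=
    (hv.continuous.continuousAt).eventually_const_lt h0
  have hF : deriv (fun t => (v t * Real.exp (p t)) ^ α) =ᶠ[𝓝 0] fun t =>
      (deriv v t + v t * deriv p t) * Real.exp (p t) * α *
        (v t * Real.exp (p t)) ^ (α - 1) := by
    filter_upwards [hev] with t ht
    exact ((hh t).rpow_const (Or.inl (mul_pos ht (Real.exp_pos _)).ne')).deriv
  have hne : v 0 * Real.exp (p 0) ≠ 0 := (mul_pos h0 (Real.exp_pos _)).ne'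
  have hG := ((((hv2.add ((hv1 0).mul hp2)).mul (hp1 0).exp).mul_const α).mul
    ((hh 0).rpow_const (p := α - 1) (Or.inl hne)))
  rw [hF.deriv_eq]
  refine hG.deriv.trans ?_
  have e1 : (v 0 * Real.exp (p 0)) ^ (α - 1) =
      (v 0 * Real.exp (p 0)) ^ (α - 2) * (v 0 * Real.exp (p 0)) := by
    rw [← Real.rpow_add_one hne]
    ring_nf
  have e2 : α - 1 - 1 = α - 2 := by ring
  simp only [Pi.add_apply, Pi.mul_apply]
  rw [e2, e1]
  ring

/-- The second derivative of a function along a line. -/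
theorem fderiv_fderiv_eq_deriv_deriv {E : Type*} [NormedAddCommGroup E] [NormedSpace ℝ E]
    {f : E → ℝ} {z : E} (hf : ContDiffAt ℝ 2 f z) (X : E) :
    fderiv ℝ (fderiv ℝ f) z X X = deriv (deriv fun t : ℝ => f (z + t • X)) 0 := by
  have hl : ∀ t : ℝ, HasDerivAt (fun t : ℝ => z + t • X) X t := fun t => by
    simpa using ((hasDerivAt_id t).smul_const X).const_add z
  have htend : Filter.Tendsto (fun t : ℝ => z + t • X) (𝓝 0) (𝓝 z) := by
    simpa using (hl 0).continuousAt.tendsto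
  have hev : deriv (fun t : ℝ => f (z + t • X)) =ᶠ[𝓝 0] fun t => fderiv ℝ f (z + t • X) X := by
    filter_upwards [htend.eventually (hf.eventually (by simp))] with t ht
    exact ((ht.differentiableAt (by norm_num)).hasFDerivAt.comp_hasDerivAt t (hl t)).deriv
  have h2 : HasFDerivAt (fderiv ℝ f) (fderiv ℝ (fderiv ℝ f) z) (z + (0 : ℝ) • X) := by
    rw [zero_smul, add_zero]
    exact ((hf.fderiv_right (m := 1) (by norm_num)).differentiableAt (by norm_num)).hasFDerivAt
  rw [hev.deriv_eq]
  have h3 : HasDerivAt (fun t : ℝ => fderiv ℝ f (z + t • X)) (fderiv ℝ (fderiv ℝ f) z X) 0 :=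
    h2.comp_hasDerivAt (0 : ℝ) (hl 0)
  have h4 := h3.clm_apply (hasDerivAt_const (0 : ℝ) X)
  rw [h4.deriv]
  simp

/-- The Levi form as an average of two real second derivatives. -/
theorem levi_self_re {n : ℕ} {f : (Fin n → ℂ) → ℝ} {z : Fin n → ℂ} (hf : ContDiffAt ℝ 2 f z)
    (X : Fin n → ℂ) :
    (levi f X X z).re = (fderiv ℝ (fderiv ℝ f) z X X +
      fderiv ℝ (fderiv ℝ f) z (Complex.I • X) (Complex.I • X)) / 4 := by
  set B := fderiv ℝ (fderiv ℝ f) z with hB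
  set e : Fin n → (Fin n → ℂ) := fun j => Pi.single j 1 with he
  set i : Fin n → (Fin n → ℂ) := fun j => Pi.single j Complex.I with hi
  have h2 : HasFDerivAt (fderiv ℝ f) B z :=
    ((hf.fderiv_right (m := 1) (by norm_num)).differentiableAt (by norm_num)).hasFDerivAt
  have hbar : ∀ k, (fun w => dzbar k (cplx f) w) =ᶠ[𝓝 z] fun w =>
      ((fderiv ℝ f w (e k) : ℂ) + Complex.I * (fderiv ℝ f w (i k) : ℂ)) / 2 := by
    intro k
    filter_upwards [hf.eventually (by simp)] with w hw
    have hd : HasFDerivAt (cplx f) (Complex.ofRealCLM ∘L fderiv ℝ f w) w :=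
      Complex.ofRealCLM.hasFDerivAt.comp w (hw.differentiableAt (by norm_num)).hasFDerivAt
    simp only [dzbar, hd.fderiv]
    rfl
  have hdz : ∀ j k, dz j (fun w => dzbar k (cplx f) w) z =
      ((B (e j) (e k) : ℂ) + Complex.I * (B (e j) (i k) : ℂ) -
        Complex.I * ((B (i j) (e k) : ℂ) + Complex.I * (B (i j) (i k) : ℂ))) / 4 := by
    intro j k
    have hcoord : ∀ u : Fin n → ℂ, HasFDerivAt (fun w => (fderiv ℝ f w u : ℂ))
        (Complex.ofRealCLM ∘L (B.flip u)) z := fun u =>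
      Complex.ofRealCLM.hasFDerivAt.comp z
        ((h2.clm_apply (hasFDerivAt_const u z)).congr_fderiv (by ext; simp))
    have hfull := ((hcoord (e k)).fun_add ((hcoord (i k)).const_mul Complex.I)).mul_const
      ((2 : ℂ)⁻¹)
    have hfd : ∀ u, fderiv ℝ (fun w => dzbar k (cplx f) w) z u =
        ((B u (e k) : ℂ) + Complex.I * (B u (i k) : ℂ)) / 2 := by
      intro u
      rw [(hbar k).fderiv_eq]
      simp only [div_eq_mul_inv]
      rw [HasFDerivAt.fderiv hfull]
      simp
      ring
    rw [dz, hfd, hfd]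
    ring
  have hX : X = ∑ j, ((X j).re • e j + (X j).im • i j) := by
    ext k
    simp [he, hi, Finset.sum_apply, Pi.single_apply, Finset.sum_add_distrib]
  have hIX : Complex.I • X = ∑ j, ((-(X j).im) • e j + (X j).re • i j) := by
    ext k
    simp only [he, hi, Finset.sum_apply, Pi.single_apply, Finset.sum_add_distrib, Pi.add_apply,
      Pi.smul_apply]
    apply Complex.ext <;> simp
  have hexp : ∀ a b : Fin n → ℝ, B (∑ j, (a j • e j + b j • i j)) (∑ j, (a j • e j + b j • i j)) =
      ∑ j, ∑ k, (a j * a k * B (e j) (e k) + a j * b k * B (e j) (i k) +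
        b j * a k * B (i j) (e k) + b j * b k * B (i j) (i k)) := by
    intro a b
    simp only [map_sum, map_add, map_smul, _root_.sum_apply, _root_.add_apply,
      _root_.smul_apply, smul_eq_mul]
    rw [Finset.sum_comm]
    refine Finset.sum_congr rfl fun j _ => ?_
    rw [Finset.mul_sum, Finset.mul_sum, ← Finset.sum_add_distrib]
    refine Finset.sum_congr rfl fun k _ => ?_
    ring
  have hBX := hexp (fun j => (X j).re) (fun j => (X j).im)
  rw [← hX] at hBX
  rw [hIX, hexp, hBX]
  rw [levi, Complex.re_sum, ← Finset.sum_add_distrib, Finset.sum_div]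
  refine Finset.sum_congr rfl fun j _ => ?_
  rw [Complex.re_sum, ← Finset.sum_add_distrib, Finset.sum_div]
  refine Finset.sum_congr rfl fun k _ => ?_
  rw [hdz]
  generalize B (e j) (e k) = b1
  generalize B (e j) (i k) = b2
  generalize B (i j) (e k) = b3
  generalize B (i j) (i k) = b4
  simp
  ring

/-- A `C²` function with positive real second derivatives has positive Levi form. -/
theorem levi_self_re_pos {n : ℕ} {f : (Fin n → ℂ) → ℝ} {z : Fin n → ℂ} (hf : ContDiffAt ℝ 2 f z)
    (hpos : ∀ X : Fin n → ℂ, X ≠ 0 → 0 < deriv (deriv fun t : ℝ => f (z + t • X)) 0)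
    {X : Fin n → ℂ} (hX : X ≠ 0) : 0 < (levi f X X z).re := by
  rw [levi_self_re hf, fderiv_fderiv_eq_deriv_deriv hf, fderiv_fderiv_eq_deriv_deriv hf]
  have h1 := hpos X hX
  have h2 := hpos (Complex.I • X) (smul_ne_zero Complex.I_ne_zero hX)
  positivity

theorem enormSq_pos {n : ℕ} {X : Fin n → ℂ} (hX : X ≠ 0) : 0 < enormSq X := by
  obtain ⟨j, hj⟩ := Function.ne_iff.1 hX
  exact Finset.sum_pos' (fun k _ => Complex.normSq_nonneg _)
    ⟨j, Finset.mem_univ j, Complex.normSq_pos.2 hj⟩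

theorem contDiff_enormSq {n : ℕ} {m : WithTop ℕ∞} : ContDiff ℝ m (enormSq (n := n)) := by
  unfold enormSq
  refine ContDiff.sum fun j _ => ?_
  have hj : ContDiff ℝ m fun z : Fin n → ℂ => z j := contDiff_apply ℝ ℂ j
  simp only [Complex.normSq_apply]
  have hre : ContDiff ℝ m fun z : Fin n → ℂ => (z j).re := Complex.reCLM.contDiff.comp hj
  have him : ContDiff ℝ m fun z : Fin n → ℂ => (z j).im := Complex.imCLM.contDiff.comp hj
  exact (hre.mul hre).add (him.mul him)

/-- Along a line, `enormSq` is a quadratic polynomial whose coefficients satisfy the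
Cauchy–Schwarz inequality. -/
theorem exists_enormSq_line {n : ℕ} (z X : Fin n → ℂ) :
    ∃ B : ℝ, B ^ 2 ≤ enormSq z * enormSq X ∧
      ∀ t : ℝ, enormSq (z + t • X) = enormSq z + 2 * B * t + enormSq X * t ^ 2 := by
  refine ⟨∑ j, ((z j).re * (X j).re + (z j).im * (X j).im), ?_, fun t => ?_⟩
  · have hle : |∑ j, ((z j).re * (X j).re + (z j).im * (X j).im)| ≤ ∑ j, ‖z j‖ * ‖X j‖ := by
      refine (Finset.abs_sum_le_sum_abs _ _).trans (Finset.sum_le_sum fun j _ => ?_)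
      have := Complex.abs_re_le_norm (z j * (starRingEnd ℂ) (X j))
      simpa [Complex.mul_re] using this
    calc _ = |∑ j, ((z j).re * (X j).re + (z j).im * (X j).im)| ^ 2 := (sq_abs _).symm
      _ ≤ (∑ j, ‖z j‖ * ‖X j‖) ^ 2 := by gcongr
      _ ≤ (∑ j, ‖z j‖ ^ 2) * ∑ j, ‖X j‖ ^ 2 := Finset.sum_mul_sq_le_sq_mul_sq _ _ _
      _ = enormSq z * enormSq X := by simp only [enormSq, Complex.normSq_eq_norm_sq]
  · simp only [enormSq, Finset.mul_sum, Finset.sum_mul, ← Finset.sum_add_distrib]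
    refine Finset.sum_congr rfl fun j _ => ?_
    simp [Complex.normSq_apply]
    ring

theorem deriv_quadratic (c A B C t : ℝ) :
    deriv (fun t : ℝ => c * (A + 2 * B * t + C * t ^ 2)) t = c * (2 * B + C * (2 * t)) := by
  have h := ((((hasDerivAt_id t).const_mul (2 * B)).const_add A).add
    (((hasDerivAt_id t).pow 2).const_mul C)).const_mul c
  exact h.deriv.trans (by simp)

theorem deriv_deriv_quadratic (c A B C t : ℝ) :
    deriv (deriv fun t : ℝ => c * (A + 2 * B * t + C * t ^ 2)) t = c * (2 * C) := by
  rw [funext (deriv_quadratic c A B C)]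
  have h := ((((hasDerivAt_id t).const_mul 2).const_mul C).const_add (2 * B)).const_mul c
  exact h.deriv.trans (by ring)

theorem ConvexOn.comp_line {E : Type*} [AddCommGroup E] [Module ℝ E] {r : E → ℝ}
    (hr : ConvexOn ℝ Set.univ r) (z X : E) :
    ConvexOn ℝ Set.univ fun t : ℝ => r (z + t • X) := by
  refine ⟨convex_univ, fun s _ t _ a b ha hb hab => ?_⟩
  have h : z + (a • s + b • t) • X = a • (z + s • X) + b • (z + t • X) := by
    calc z + (a • s + b • t) • X = (a + b) • z + (a • s + b • t) • X := by rw [hab, one_smul]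
      _ = _ := by simp only [smul_eq_mul]; module
  beta_reduce
  rw [h]
  exact hr.2 (Set.mem_univ _) (Set.mem_univ _) ha hb hab

theorem contDiff_comp_line {E : Type*} [NormedAddCommGroup E] [NormedSpace ℝ E] {r : E → ℝ}
    {m : WithTop ℕ∞} (hr : ContDiff ℝ m r) (z X : E) :
    ContDiff ℝ m fun t : ℝ => r (z + t • X) :=
  hr.comp (contDiff_const.add (contDiff_id.smul contDiff_const))

theorem ConvexOn.deriv_deriv_line_nonneg {E : Type*} [NormedAddCommGroup E] [NormedSpace ℝ E]
    {r : E → ℝ} (hr : ConvexOn ℝ Set.univ r) (hs : ContDiff ℝ 2 r) (z X : E) :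
    0 ≤ deriv (deriv fun t : ℝ => r (z + t • X)) 0 := by
  have hd := (contDiff_comp_line hs z X).differentiable (by norm_num)
  exact (monotoneOn_univ.1 ((hr.comp_line z X).monotoneOn_deriv fun t _ => hd t)).deriv_nonneg

/-- A convex function has nonzero differential wherever it is not minimal. -/
theorem ConvexOn.fderiv_ne_zero {E : Type*} [NormedAddCommGroup E] [NormedSpace ℝ E]
    {r : E → ℝ} (hr : ConvexOn ℝ Set.univ r) {p y : E} (hd : DifferentiableAt ℝ r p)
    (hlt : r y < r p) : fderiv ℝ r p ≠ 0 := by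
  intro h0
  have hl : HasDerivAt (fun t : ℝ => p + t • (y - p)) (y - p) 0 := by
    simpa using ((hasDerivAt_id (0 : ℝ)).smul_const (y - p)).const_add p
  have hd' : HasFDerivAt r (fderiv ℝ r p) (p + (0 : ℝ) • (y - p)) := by
    rw [zero_smul, add_zero]
    exact hd.hasFDerivAt
  have h1 : HasDerivAt (fun t : ℝ => r (p + t • (y - p))) 0 0 := by
    have := hd'.comp_hasDerivAt (0 : ℝ) hl
    rwa [h0, _root_.zero_apply] at this
  have h2 := (hr.comp_line p (y - p)).le_slope_of_hasDerivAt (Set.mem_univ 0) (Set.mem_univ 1)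
    one_pos h1
  simp [slope_def_field] at h2
  linarith

/-- Second derivative along a line of a power of `w` times a Gaussian weight. -/
theorem exists_deriv_deriv_weighted_rpow {n : ℕ} {w : (Fin n → ℂ) → ℝ} (hw : ContDiff ℝ 2 w)
    {z : Fin n → ℂ} (hz : 0 < w z) (c α : ℝ) (X : Fin n → ℂ) :
    ∃ K a B : ℝ, 0 < K ∧ B ^ 2 ≤ enormSq z * enormSq X ∧
      deriv (deriv fun t : ℝ =>
          (w (z + t • X) * Real.exp (c * enormSq (z + t • X))) ^ α) 0 =
        α * K * (w z * deriv (deriv fun t : ℝ => w (z + t • X)) 0 - a ^ 2 +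
          w z ^ 2 * (c * (2 * enormSq X)) + α * (a + w z * (c * (2 * B))) ^ 2) := by
  obtain ⟨B, hB, hline⟩ := exists_enormSq_line z X
  have hz0 : w (z + (0 : ℝ) • X) = w z := by rw [zero_smul, add_zero]
  have hp : ContDiff ℝ 2 fun t : ℝ => c * (enormSq z + 2 * B * t + enormSq X * t ^ 2) := by
    fun_prop
  have h := deriv_deriv_mul_exp_rpow (contDiff_comp_line hw z X) hp
    (show 0 < w (z + (0 : ℝ) • X) from hz0.symm ▸ hz) α
  rw [deriv_deriv_quadratic, deriv_quadratic, hz0] at h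
  rw [show enormSq z + 2 * B * 0 + enormSq X * 0 ^ 2 = enormSq z by ring,
    show 2 * B + enormSq X * (2 * 0) = 2 * B by ring, mul_assoc α] at h
  refine ⟨(w z * Real.exp (c * enormSq z)) ^ (α - 2) * Real.exp (c * enormSq z) ^ 2,
    deriv (fun t : ℝ => w (z + t • X)) 0, B, by positivity, hB, ?_⟩
  simp only [hline]
  exact h

theorem weighted_pos_of_one_lt {v v₂ a α ε A B C : ℝ} (hv : 0 < v) (hv₂ : 0 ≤ v₂) (hα : 1 < α)
    (hε : 0 < ε) (hC : 0 < C) (hB : B ^ 2 ≤ A * C) (hA : 2 * ε * α * A < α - 1) :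
    0 < v * v₂ - a ^ 2 + v ^ 2 * (ε * (2 * C)) + α * (a + v * (ε * (2 * B))) ^ 2 := by
  have h1 : 0 < α - 1 := by linarith
  have h2 : 0 ≤ v * v₂ := mul_nonneg hv.le hv₂
  have h3 : 2 * ε * α * B ^ 2 < (α - 1) * C := by
    calc 2 * ε * α * B ^ 2 ≤ 2 * ε * α * (A * C) := by gcongr
      _ = (2 * ε * α * A) * C := by ring
      _ < (α - 1) * C := by gcongr
  have h4 : 0 < 2 * ε * v ^ 2 * ((α - 1) * C - 2 * ε * α * B ^ 2) :=
    mul_pos (by positivity) (by linarith)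
  refine pos_of_mul_pos_right (a := α - 1) ?_ h1.le
  nlinarith [sq_nonneg ((α - 1) * a + α * (v * (ε * (2 * B)))), mul_nonneg h1.le h2]

theorem weighted_neg_of_lt_one {v v₂ a α ε A B C : ℝ} (hv : 0 < v) (hv₂ : v₂ ≤ 0) (hα₀ : 0 < α)
    (hα : α < 1) (hε : 0 < ε) (hC : 0 < C) (hB : B ^ 2 ≤ A * C)
    (hA : 2 * ε * α * A < 1 - α) :
    v * v₂ - a ^ 2 + v ^ 2 * (-ε * (2 * C)) + α * (a + v * (-ε * (2 * B))) ^ 2 < 0 := by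
  have h1 : 0 < 1 - α := by linarith
  have h2 : 0 ≤ v * -v₂ := mul_nonneg hv.le (by linarith)
  have h3 : 2 * ε * α * B ^ 2 < (1 - α) * C := by
    calc 2 * ε * α * B ^ 2 ≤ 2 * ε * α * (A * C) := by gcongr
      _ = (2 * ε * α * A) * C := by ring
      _ < (1 - α) * C := by gcongr
  have h4 : 0 < 2 * ε * v ^ 2 * ((1 - α) * C - 2 * ε * α * B ^ 2) :=
    mul_pos (by positivity) (by linarith)
  rw [← neg_pos]
  refine pos_of_mul_pos_right (a := 1 - α) ?_ h1.le
  nlinarith [sq_nonneg ((1 - α) * a - α * (v * (-ε * (2 * B)))), mul_nonneg h1.le h2]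

theorem contDiffAt_weighted_rpow {n : ℕ} {w : (Fin n → ℂ) → ℝ} (hw : ContDiff ℝ 2 w)
    {z : Fin n → ℂ} (hz : 0 < w z) (c α : ℝ) :
    ContDiffAt ℝ 2 (fun z => (w z * Real.exp (c * enormSq z)) ^ α) z :=
  (hw.mul (contDiff_const.mul contDiff_enormSq).exp).contDiffAt.rpow_const_of_ne
    (mul_pos hz (Real.exp_pos _)).ne'

/-- The weighted defining function built from a convex one. -/
theorem isDefFn_weighted {n : ℕ} {Ω : Set (Fin n → ℂ)} {r : (Fin n → ℂ) → ℝ}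
    (hΩ : IsOpen Ω) (hne : Ω.Nonempty) (hs : ContDiff ℝ (⊤ : ℕ∞) r)
    (hr : ConvexOn ℝ Set.univ r) (hlt : ∀ z, z ∈ Ω ↔ r z < 0)
    (hle : ∀ z, z ∈ closure Ω ↔ r z ≤ 0) (c : ℝ) :
    IsDefFn Ω Set.univ fun z => r z * Real.exp (c * enormSq z) where
  isOpen := isOpen_univ
  subset := Set.subset_univ _
  smooth := (hs.mul (contDiff_const.mul contDiff_enormSq).exp).contDiffOn
  eq := by
    ext z
    simp [hlt, mul_neg_iff, Real.exp_pos, (Real.exp_pos _).not_gt]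
  grad_ne := by
    intro p hp h0
    obtain ⟨x₀, hx₀⟩ := hne
    have hrp : r p = 0 := by
      rw [hΩ.frontier_eq] at hp
      exact le_antisymm ((hle p).1 hp.1) (not_lt.1 fun h => hp.2 ((hlt p).2 h))
    have hd : DifferentiableAt ℝ r p := hs.differentiable (by simp) p
    have he : DifferentiableAt ℝ (fun z : Fin n → ℂ => Real.exp (c * enormSq z)) p :=
      ((contDiff_const.mul contDiff_enormSq).exp (n := 1)).differentiable (by simp) p
    have hmul := (hd.hasFDerivAt.fun_mul he.hasFDerivAt).fderiv
    rw [h0, hrp, zero_smul, zero_add] at hmul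
    refine hr.fderiv_ne_zero hd (hrp.symm ▸ (hlt x₀).1 hx₀) ?_
    exact (smul_eq_zero.1 hmul.symm).resolve_left (Real.exp_pos _).ne'

theorem exists_enormSq_le {n : ℕ} {S : Set (Fin n → ℂ)} (hS : Bornology.IsBounded S) :
    ∃ M : ℝ, 0 < M ∧ ∀ z ∈ S, enormSq z < M := by
  obtain ⟨M, hM⟩ := (hS.isCompact_closure.image
    (contDiff_enormSq (n := n) (m := 0)).continuous).bddAbove
  refine ⟨max M 0 + 1, by positivity, fun z hz => ?_⟩
  have := hM ⟨z, subset_closure hz, rfl⟩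
  have := le_max_left M 0
  linarith

theorem exists_weight {α δ M : ℝ} (hα : 0 < α) (hδ : 0 < δ) (hM : 0 < M) :
    ∃ ε : ℝ, 0 < ε ∧ ∀ A < M, 2 * ε * α * A < δ := by
  refine ⟨δ / (2 * α * M), by positivity, fun A hA => ?_⟩
  have h : 2 * (δ / (2 * α * M)) * α * A = δ * (A / M) := by field_simp
  rw [h]
  have : A / M < 1 := (div_lt_one hM).2 hA
  nlinarith

theorem mem_dfExpSet_weighted {n : ℕ} {Ω : Set (Fin n → ℂ)} {r : (Fin n → ℂ) → ℝ}
    (hs : ContDiff ℝ (⊤ : ℕ∞) r) (hr : ConvexOn ℝ Set.univ r) (hlt : ∀ z ∈ Ω, r z < 0)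
    {α ε : ℝ} (hα₀ : 0 < α) (hα : α < 1) (hε : 0 < ε)
    (hA : ∀ z ∈ Ω, 2 * ε * α * enormSq z < 1 - α) :
    α ∈ dfExpSet Ω fun z => r z * Real.exp (-ε * enormSq z) := by
  refine ⟨hα₀, hα, fun z hz X hX => ?_⟩
  have hs2 : ContDiff ℝ 2 r := contDiff_infty.1 hs 2
  have hz' : 0 < -r z := neg_pos.2 (hlt z hz)
  simp only [← neg_mul (r _)]
  refine levi_self_re_pos (contDiffAt_weighted_rpow hs2.neg hz' (-ε) α).neg
    (fun Y hY => ?_) hX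
  obtain ⟨K, a, B, hK, hB, h⟩ := exists_deriv_deriv_weighted_rpow hs2.neg hz' (-ε) α Y
  rw [show (fun t : ℝ => -(-r (z + t • Y) * Real.exp (-ε * enormSq (z + t • Y))) ^ α) =
    -fun t : ℝ => (-r (z + t • Y) * Real.exp (-ε * enormSq (z + t • Y))) ^ α from rfl,
    deriv.neg', deriv.fun_neg, h, neg_pos]
  refine mul_neg_of_pos_of_neg (by positivity)
    (weighted_neg_of_lt_one hz' ?_ hα₀ hα hε (enormSq_pos hY) hB (hA z hz))
  have h2 := hr.deriv_deriv_line_nonneg hs2 z Y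
  rw [show (fun t : ℝ => -r (z + t • Y)) = -fun t : ℝ => r (z + t • Y) from rfl,
    deriv.neg', deriv.fun_neg]
  linarith

theorem mem_steinExpSet_weighted {n : ℕ} {Ω : Set (Fin n → ℂ)} {r : (Fin n → ℂ) → ℝ}
    (hs : ContDiff ℝ (⊤ : ℕ∞) r) (hr : ConvexOn ℝ Set.univ r)
    (hpos : ∀ z ∉ closure Ω, 0 < r z) {α ε M : ℝ} (hα : 1 < α) (hε : 0 < ε)
    (hM : ∀ z ∈ frontier Ω, enormSq z < M) (hA : ∀ A < M, 2 * ε * α * A < α - 1) :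
    α ∈ steinExpSet Ω fun z => r z * Real.exp (ε * enormSq z) := by
  refine ⟨hα, {z | enormSq z < M},
    isOpen_lt (contDiff_enormSq (m := 0)).continuous continuous_const, hM,
    fun z hz X hX => ?_⟩
  have hs2 : ContDiff ℝ 2 r := contDiff_infty.1 hs 2
  have hz' : 0 < r z := hpos z hz.1
  refine levi_self_re_pos (contDiffAt_weighted_rpow hs2 hz' ε α) (fun Y hY => ?_) hX
  obtain ⟨K, a, B, hK, hB, h⟩ := exists_deriv_deriv_weighted_rpow hs2 hz' ε α Y
  rw [h]
  exact mul_pos (by positivity) (weighted_pos_of_one_lt hz'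
    (hr.deriv_deriv_line_nonneg hs2 z Y) hα hε (enormSq_pos hY) hB (hA _ hz.2))

theorem dfExp_le_one {n : ℕ} (Ω : Set (Fin n → ℂ)) (ρ : (Fin n → ℂ) → ℝ) : dfExp Ω ρ ≤ 1 := by
  refine csSup_le (Set.insert_nonempty _ _) ?_
  rintro t (rfl | ht)
  · exact zero_le_one
  · exact ht.2.1.le

theorem le_dfExp {n : ℕ} {Ω : Set (Fin n → ℂ)} {ρ : (Fin n → ℂ) → ℝ} {α : ℝ}
    (hα : α ∈ dfExpSet Ω ρ) : α ≤ dfExp Ω ρ := by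
  refine le_csSup ⟨1, ?_⟩ (Set.mem_insert_of_mem _ hα)
  rintro t (rfl | ht)
  · exact zero_le_one
  · exact ht.2.1.le

/-- Corollary 7.2: for a bounded convex domain in `ℂⁿ` with smooth
boundary, `DF(Ω) = 1` and `S(Ω) = 1`. -/
theorem convex_domain_indices_eq_one {n : ℕ} (hn : 2 ≤ n) (Ω : Set (Fin n → ℂ))
    (hΩ : IsOpen Ω) (hne : Ω.Nonempty) (hbd : Bornology.IsBounded Ω)
    (hconv : Convex ℝ Ω)
    (hsmooth : ∃ (V : Set (Fin n → ℂ)) (ρ : (Fin n → ℂ) → ℝ), IsDefFn Ω V ρ) :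
    dfIndex Ω = 1 ∧ steinIndex Ω = 1 := by
  obtain ⟨V, ρ, hρ⟩ := hsmooth
  obtain ⟨r, hs, hr, hlt, hle⟩ := exists_convexOn_defining hΩ hne hbd hconv hρ.isOpen hρ.subset
    hρ.smooth hρ.eq hρ.grad_ne
  obtain ⟨M, hM, hMΩ⟩ := exists_enormSq_le hbd.closure
  constructor
  · have hbdd : BddAbove {t : ℝ | ∃ V ρ, IsDefFn Ω V ρ ∧ t = dfExp Ω ρ} := by
      refine ⟨1, ?_⟩
      rintro t ⟨V, ρ, -, rfl⟩
      exact dfExp_le_one Ω ρ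
    refine le_antisymm (csSup_le ⟨_, V, ρ, hρ, rfl⟩ ?_) ?_
    · rintro t ⟨V, ρ, -, rfl⟩
      exact dfExp_le_one Ω ρ
    · refine le_of_forall_lt fun α hα => ?_
      set β := (max α 0 + 1) / 2 with hβ
      have hm : max α 0 < 1 := max_lt hα one_pos
      have hm0 : 0 ≤ max α 0 := le_max_right _ _
      have hβ0 : 0 < β := by positivity
      have hβ1 : β < 1 := by rw [hβ]; linarith
      have hαβ : α < β := by
        have := le_max_left α 0
        rw [hβ]
        linarith
      obtain ⟨ε, hε, hA⟩ := exists_weight hβ0 (sub_pos.2 hβ1) hM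
      refine hαβ.trans_le ((le_dfExp (mem_dfExpSet_weighted hs hr (fun z hz => (hlt z).1 hz)
        hβ0 hβ1 hε fun z hz => hA _ (hMΩ z (subset_closure hz)))).trans ?_)
      exact le_csSup hbdd ⟨_, _, isDefFn_weighted hΩ hne hs hr hlt hle _, rfl⟩
  · refine le_antisymm ?_ ?_
    · refine le_of_forall_gt fun c hc => ?_
      obtain ⟨q, hq1, hqc⟩ := ENNReal.lt_iff_exists_nnreal_btwn.1 hc
      have hq : (1 : ℝ) < q := by exact_mod_cast hq1
      obtain ⟨ε, hε, hA⟩ := exists_weight (one_pos.trans hq) (sub_pos.2 hq) hM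
      have hmem := mem_steinExpSet_weighted hs hr
        (fun z hz => not_le.1 fun h => hz ((hle z).2 h)) hq hε
        (fun z hz => hMΩ z (frontier_subset_closure hz)) hA
      calc steinIndex Ω ≤ steinExp Ω fun z => r z * Real.exp (ε * enormSq z) :=
            iInf_le_of_le _ (iInf_le_of_le _
              (iInf_le _ (isDefFn_weighted hΩ hne hs hr hlt hle ε)))
        _ ≤ ENNReal.ofReal q := sInf_le (Set.mem_image_of_mem _ hmem)
        _ = q := ENNReal.ofReal_coe_nnreal
        _ < c := hqc
    · refine le_iInf fun V => le_iInf fun ρ => le_iInf fun _ => le_sInf ?_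
      rintro _ ⟨η, hη, rfl⟩
      rw [ENNReal.one_le_ofReal]
      exact hη.1.le
end
end
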